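/- arXiv:2104.09077 — 2 statements merged into one kernel-verified Lean document; each statement's English description precedes it below -/
import Mathlib

section
/- There is an absolute constant C > 0 such that for every f ∈ H²(ℝ²) and every t ≥ 0: ‖f‖_{L^∞(ℝ²)} ≤ C [ ‖∇f‖_{L²(ℝ²)} (ln(e + t))^{1/2} + (1 + t)^{−1} ( ‖f‖_{L²(ℝ²)} + ‖∇²f‖_{L²(ℝ²)} ) ]. -/
/-!
STATEMENT 7: Logarithmic Sobolev-type inequality on ℝ² (Lemma 3.1 / `sob`):
‖f‖_{L∞(ℝ²)} ≤ C [ ‖∇f‖_{L²} (ln(e+t))^{1/2} + (1+t)^{-1}(‖f‖_{L²} + ‖∇²f‖_{L²}) ].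
-/

noncomputable section
open MeasureTheory
open scoped ENNReal

namespace Stmt7

abbrev Pt2 : Type := EuclideanSpace ℝ (Fin 2)

def pd (j : Fin 2) (f : Pt2 → ℝ) : Pt2 → ℝ :=
  fun x => fderiv ℝ f x (EuclideanSpace.single j 1)

/-- Pointwise norm of the gradient. -/
def gradNorm (f : Pt2 → ℝ) : Pt2 → ℝ :=
  fun x => Real.sqrt (∑ j, (pd j f x)^2)

/-- Pointwise norm of the Hessian (array of all second derivatives). -/
def hessNorm (f : Pt2 → ℝ) : Pt2 → ℝ :=
  fun x => Real.sqrt (∑ i, ∑ j, (pd i (pd j f) x)^2)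

open Set

lemma enorm_intervalIntegral_le {a b : ℝ} (hab : a ≤ b) {u : ℝ → ℝ} {U : ℝ → ℝ≥0∞}
    (h : ∀ r ∈ Ioc a b, ‖u r‖ₑ ≤ U r) :
    ‖∫ r in a..b, u r‖ₑ ≤ ∫⁻ r in Ioc a b, U r := by
  rw [intervalIntegral.integral_of_le hab]
  exact (enorm_integral_le_lintegral_enorm _).trans (setLIntegral_mono' measurableSet_Ioc h)

/-- The value at the endpoint of a half-line in terms of weighted integrals of the function and
its first two derivatives. -/
lemma eq_weighted_integrals {g g₁ g₂ : ℝ → ℝ} (h₁ : ∀ r, HasDerivAt g (g₁ r) r)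
    (h₂ : ∀ r, HasDerivAt g₁ (g₂ r) r) (hc : Continuous g₂) {ε R : ℝ} (hε : 0 < ε)
    (hR : 0 < R) :
    g 0 = (∫ r in (0 : ℝ)..ε, (r ^ 2 / R ^ 2 - 2 * r / ε) * g₁ r)
      + (∫ r in (0 : ℝ)..ε, r * (1 - r / ε) * g₂ r)
      - (∫ r in ε..R, (1 - r ^ 2 / R ^ 2) * g₁ r)
      + ∫ r in (0 : ℝ)..R, 2 * r / R ^ 2 * g r := by
  have c₀ : Continuous g := continuous_iff_continuousAt.2 fun r => (h₁ r).continuousAt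
  have c₁ : Continuous g₁ := continuous_iff_continuousAt.2 fun r => (h₂ r).continuousAt
  have e₁ : ∫ r in (0 : ℝ)..R, ((1 - r ^ 2 / R ^ 2) * g₁ r - 2 * r / R ^ 2 * g r) = -g 0 := by
    rw [intervalIntegral.integral_eq_sub_of_hasDerivAt
      (f := fun r => (1 - r ^ 2 / R ^ 2) * g r)]
    · field_simp
      ring
    · intro r _
      convert! ((((hasDerivAt_id r).pow 2).div_const (R ^ 2)).const_sub 1).mul (h₁ r) using 1
      simp
      ring
    · exact Continuous.intervalIntegrable (by fun_prop) _ _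
  have e₂ : ∫ r in (0 : ℝ)..ε, ((1 - 2 * r / ε) * g₁ r + r * (1 - r / ε) * g₂ r) = 0 := by
    rw [intervalIntegral.integral_eq_sub_of_hasDerivAt
      (f := fun r => r * (1 - r / ε) * g₁ r)]
    · field_simp
      ring
    · intro r _
      convert! ((hasDerivAt_id r).mul (((hasDerivAt_id r).div_const ε).const_sub 1)).mul (h₂ r)
        using 1
      simp only [id_eq, Pi.mul_apply]
      ring
    · exact Continuous.intervalIntegrable (by fun_prop) _ _
  rw [intervalIntegral.integral_sub (Continuous.intervalIntegrable (by fun_prop) _ _)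
    (Continuous.intervalIntegrable (by fun_prop) _ _),
    ← intervalIntegral.integral_add_adjacent_intervals (b := ε)
      (Continuous.intervalIntegrable (by fun_prop) _ _)
      (Continuous.intervalIntegrable (by fun_prop) _ _)] at e₁
  rw [intervalIntegral.integral_add (Continuous.intervalIntegrable (by fun_prop) _ _)
    (Continuous.intervalIntegrable (by fun_prop) _ _)] at e₂
  have e₃ : (∫ r in (0 : ℝ)..ε, (r ^ 2 / R ^ 2 - 2 * r / ε) * g₁ r)
      = (∫ r in (0 : ℝ)..ε, (1 - 2 * r / ε) * g₁ r)
        - ∫ r in (0 : ℝ)..ε, (1 - r ^ 2 / R ^ 2) * g₁ r := by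
    rw [← intervalIntegral.integral_sub (Continuous.intervalIntegrable (by fun_prop) _ _)
      (Continuous.intervalIntegrable (by fun_prop) _ _)]
    congr 1
    ext r
    ring
  linarith

lemma enorm_mul_le_of_abs_le {r w c y : ℝ} {Y : ℝ≥0∞} (hr : 0 ≤ r)
    (hc : |c| ≤ r * w) (hy : ‖y‖ₑ ≤ Y) :
    ‖c * y‖ₑ ≤ ENNReal.ofReal r * (ENNReal.ofReal w * Y) := by
  rw [enorm_mul, ← mul_assoc, ← ENNReal.ofReal_mul hr]
  gcongr
  rw [Real.enorm_eq_ofReal_abs]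
  exact ENNReal.ofReal_le_ofReal hc

lemma enorm_zero_le_weighted_lintegrals {g g₁ g₂ : ℝ → ℝ} {G₀ G₁ G₂ : ℝ → ℝ≥0∞}
    (h₁ : ∀ r, HasDerivAt g (g₁ r) r) (h₂ : ∀ r, HasDerivAt g₁ (g₂ r) r) (hc : Continuous g₂)
    (b₀ : ∀ r, ‖g r‖ₑ ≤ G₀ r) (b₁ : ∀ r, ‖g₁ r‖ₑ ≤ G₁ r) (b₂ : ∀ r, ‖g₂ r‖ₑ ≤ G₂ r)
    {ε R : ℝ} (hε : 0 < ε) (hεR : ε ≤ R) :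
    ‖g 0‖ₑ ≤ (∫⁻ r in Ioc 0 ε, ENNReal.ofReal r * (ENNReal.ofReal (2 / ε) * G₁ r))
      + (∫⁻ r in Ioc 0 ε, ENNReal.ofReal r * (ENNReal.ofReal 1 * G₂ r))
      + (∫⁻ r in Ioc ε R, ENNReal.ofReal r * (ENNReal.ofReal r⁻¹ * G₁ r))
      + ∫⁻ r in Ioc 0 R, ENNReal.ofReal r * (ENNReal.ofReal (2 / R ^ 2) * G₀ r) := by
  have hR : 0 < R := hε.trans_le hεR
  rw [eq_weighted_integrals h₁ h₂ hc hε hR]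
  refine (enorm_add_le _ _).trans (add_le_add ((enorm_sub_le).trans
    (add_le_add ((enorm_add_le _ _).trans (add_le_add ?_ ?_)) ?_)) ?_)
  · refine enorm_intervalIntegral_le hε.le fun r hr => ?_
    refine enorm_mul_le_of_abs_le hr.1.le ?_ (b₁ r)
    have hle : r ^ 2 / R ^ 2 ≤ r / ε := by
      have : ε * r ≤ R * R := mul_le_mul hεR (hr.2.trans hεR) hr.1.le hR.le
      rw [div_le_div_iff₀ (by positivity) hε]
      nlinarith [hr.1]
    have hn : 0 ≤ r / ε := div_nonneg hr.1.le hε.le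
    have hn2 : 0 ≤ r ^ 2 / R ^ 2 := by positivity
    have e1 : 2 * r / ε = 2 * (r / ε) := by ring
    have e2 : r * (2 / ε) = 2 * (r / ε) := by ring
    rw [e1, e2, abs_le]
    constructor <;> linarith
  · refine enorm_intervalIntegral_le hε.le fun r hr => ?_
    refine enorm_mul_le_of_abs_le hr.1.le ?_ (b₂ r)
    have hn : 0 ≤ r / ε := div_nonneg hr.1.le hε.le
    have hn2 : r / ε ≤ 1 := (div_le_one hε).2 hr.2
    rw [abs_mul, abs_of_pos hr.1]
    gcongr
    · exact hr.1.le
    · rw [abs_le]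
      constructor <;> linarith
  · refine enorm_intervalIntegral_le hεR fun r hr => ?_
    have hr0 : 0 < r := hε.trans hr.1
    refine enorm_mul_le_of_abs_le hr0.le ?_ (b₁ r)
    have hn : 0 ≤ r ^ 2 / R ^ 2 := by positivity
    have hn2 : r ^ 2 / R ^ 2 ≤ 1 :=
      (div_le_one (by positivity)).2 (pow_le_pow_left₀ hr0.le hr.2 2)
    rw [mul_inv_cancel₀ hr0.ne', abs_le]
    constructor <;> linarith
  · refine enorm_intervalIntegral_le hR.le fun r hr => ?_
    refine enorm_mul_le_of_abs_le hr.1.le ?_ (b₀ r)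
    have hr0 := hr.1
    rw [abs_of_nonneg (by positivity)]
    exact le_of_eq (by ring)

/-- Integration in polar coordinates on the plane. -/
lemma lintegral_eq_lintegral_toSphere {F : Pt2 → ℝ≥0∞} (hF : Measurable F) :
    ∫⁻ y, F y = ∫⁻ θ, (∫⁻ r in Ioi (0 : ℝ), ENNReal.ofReal r * F (r • (θ : Pt2)))
      ∂(volume : Measure Pt2).toSphere := by
  have hmp := (volume : Measure Pt2).measurePreserving_homeomorphUnitSphereProd
  have hd : Module.finrank ℝ Pt2 - 1 = 1 := by simp
  rw [hd] at hmp
  have hmp' := hmp.symm (homeomorphUnitSphereProd Pt2).toMeasurableEquiv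
  have hFm : Measurable fun p : Metric.sphere (0 : Pt2) 1 × Ioi (0 : ℝ) =>
      F (p.2.1 • p.1.1) := by
    fun_prop
  calc ∫⁻ y, F y = ∫⁻ y : ({0}ᶜ : Set Pt2), F y ∂(volume.comap Subtype.val) := by
        rw [lintegral_subtype_comap (measurableSet_singleton _).compl,
          restrict_compl_singleton]
    _ = ∫⁻ p, F (p.2.1 • p.1.1)
          ∂((volume : Measure Pt2).toSphere.prod (Measure.volumeIoiPow 1)) := by
        exact (hmp'.lintegral_comp (hF.comp measurable_subtype_coe)).symm
    _ = _ := by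
        rw [lintegral_prod _ hFm.aemeasurable]
        refine lintegral_congr fun θ => ?_
        rw [Measure.volumeIoiPow, lintegral_withDensity_eq_lintegral_mul _ (by fun_prop)
          (by fun_prop), ← lintegral_subtype_comap measurableSet_Ioi]
        simp

lemma lintegral_shell_eq {a b : ℝ} (ha : 0 ≤ a) {F : Pt2 → ℝ≥0∞} (hF : Measurable F) :
    ∫⁻ θ, (∫⁻ r in Ioc a b, ENNReal.ofReal r * F (r • (θ : Pt2))) ∂(volume : Measure Pt2).toSphere
      = ∫⁻ y in {y : Pt2 | ‖y‖ ∈ Ioc a b}, F y := by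
  have hm : MeasurableSet {y : Pt2 | ‖y‖ ∈ Ioc a b} := measurable_norm measurableSet_Ioc
  rw [← lintegral_indicator hm, lintegral_eq_lintegral_toSphere (hF.indicator hm)]
  refine lintegral_congr fun θ => ?_
  have hs : Ioc a b ⊆ Ioi 0 := fun r hr => ha.trans_lt hr.1
  rw [← lintegral_indicator measurableSet_Ioc, ← lintegral_indicator measurableSet_Ioi]
  refine lintegral_congr fun r => ?_
  by_cases h0 : 0 < r
  · have hn : ‖r • (θ : Pt2)‖ = r := by
      rw [norm_smul, norm_eq_of_mem_sphere, mul_one, Real.norm_of_nonneg h0.le]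
    by_cases hr : r ∈ Ioc a b
    · rw [indicator_of_mem hr, indicator_of_mem (show r ∈ Ioi 0 from h0),
        indicator_of_mem (by simpa [hn] using hr)]
    · rw [indicator_of_notMem hr, indicator_of_mem (show r ∈ Ioi 0 from h0),
        indicator_of_notMem (by simpa [hn] using hr), mul_zero]
  · rw [indicator_of_notMem (fun h => h0 (hs h)), indicator_of_notMem (by simpa using h0)]

lemma toSphere_univ_plane :
    (volume : Measure Pt2).toSphere univ = ENNReal.ofReal (2 * Real.pi) := by
  rw [Measure.toSphere_apply_univ, EuclideanSpace.volume_ball_fin_two,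
    ENNReal.ofReal_mul zero_le_two]
  simp

/-- Cauchy-Schwarz for a radial weight on a shell, in polar coordinates. -/
lemma lintegral_shell_mul_le {a b : ℝ} (ha : 0 ≤ a) {w : ℝ → ℝ} (hw : Measurable w)
    {F : Pt2 → ℝ≥0∞} (hF : Measurable F) {K : ℝ} {N : ℝ≥0∞}
    (hK : ∫⁻ r in Ioc a b, ENNReal.ofReal r * ENNReal.ofReal (w r) ^ 2 ≤ ENNReal.ofReal K)
    (hN : (∫⁻ y, F y ^ (2 : ℝ)) ^ (1 / 2 : ℝ) ≤ N) :
    ∫⁻ θ, (∫⁻ r in Ioc a b, ENNReal.ofReal r * (ENNReal.ofReal (w r) * F (r • (θ : Pt2))))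
        ∂(volume : Measure Pt2).toSphere
      ≤ ENNReal.ofReal (Real.sqrt (2 * Real.pi * K)) * N := by
  set S : Set Pt2 := {y : Pt2 | ‖y‖ ∈ Ioc a b}
  have hnorm : ∀ (θ : Metric.sphere (0 : Pt2) 1), ∀ r ∈ Ioc a b, ‖r • (θ : Pt2)‖ = r := by
    intro θ r hr
    rw [norm_smul, norm_eq_of_mem_sphere, mul_one, Real.norm_of_nonneg (ha.trans hr.1.le)]
  have hW : Measurable fun y : Pt2 => ENNReal.ofReal (w ‖y‖) := by fun_prop
  have e₁ : ∫⁻ θ, (∫⁻ r in Ioc a b, ENNReal.ofReal r * (ENNReal.ofReal (w r) * F (r • (θ : Pt2))))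
        ∂(volume : Measure Pt2).toSphere = ∫⁻ y in S, ENNReal.ofReal (w ‖y‖) * F y := by
    refine Eq.trans ?_ (lintegral_shell_eq ha (hW.mul hF))
    refine lintegral_congr fun θ => setLIntegral_congr_fun measurableSet_Ioc fun r hr => ?_
    simp only [hnorm θ r hr]
  have e₂ : ∫⁻ y in S, ENNReal.ofReal (w ‖y‖) ^ (2 : ℝ) ≤ ENNReal.ofReal (2 * Real.pi * K) := by
    simp only [ENNReal.rpow_two]
    rw [← lintegral_shell_eq ha (hW.pow_const 2)]
    calc _ = ∫⁻ _, (∫⁻ r in Ioc a b, ENNReal.ofReal r * ENNReal.ofReal (w r) ^ 2)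
          ∂(volume : Measure Pt2).toSphere := by
          refine lintegral_congr fun θ => setLIntegral_congr_fun measurableSet_Ioc fun r hr => ?_
          simp only [hnorm θ r hr]
      _ ≤ _ := by
          rw [lintegral_const, toSphere_univ_plane, mul_comm,
            ENNReal.ofReal_mul (q := K) (by positivity)]
          exact mul_le_mul_right hK _
  rw [e₁]
  refine (ENNReal.lintegral_mul_le_Lp_mul_Lq (volume.restrict S) Real.HolderConjugate.two_two
    hW.aemeasurable hF.aemeasurable).trans ?_
  gcongr
  · rw [Real.sqrt_eq_rpow]
    by_cases hK0 : 0 ≤ 2 * Real.pi * K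
    · rw [← ENNReal.ofReal_rpow_of_nonneg hK0 (by norm_num)]
      gcongr
    · rw [ENNReal.ofReal_of_nonpos (not_le.1 hK0).le] at e₂
      rw [nonpos_iff_eq_zero.1 e₂]
      simp
  · refine le_trans ?_ hN
    gcongr
    exact Measure.restrict_le_self

lemma lintegral_Ioc_const_weight_le {b c : ℝ} (hb : 0 ≤ b) (hc : 0 ≤ c) :
    ∫⁻ r in Ioc 0 b, ENNReal.ofReal r * ENNReal.ofReal c ^ 2 ≤ ENNReal.ofReal (b ^ 2 * c ^ 2) := by
  calc _ ≤ ∫⁻ _ in Ioc 0 b, ENNReal.ofReal (b * c ^ 2) := by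
        refine setLIntegral_mono' measurableSet_Ioc fun r hr => ?_
        rw [← ENNReal.ofReal_pow hc, ← ENNReal.ofReal_mul hr.1.le]
        gcongr
        exact hr.2
    _ = _ := by
        rw [setLIntegral_const, Real.volume_Ioc, ← ENNReal.ofReal_mul (by positivity)]
        congr 1
        ring

lemma lintegral_Ioc_inv_weight {a b : ℝ} (ha : 0 < a) (hab : a ≤ b) :
    ∫⁻ r in Ioc a b, ENNReal.ofReal r * ENNReal.ofReal r⁻¹ ^ 2
      = ENNReal.ofReal (Real.log (b / a)) := by
  have hpos : ∀ r ∈ Ioc a b, 0 < r := fun r hr => ha.trans hr.1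
  have hi : IntervalIntegrable (fun r : ℝ => r⁻¹) volume a b :=
    intervalIntegrable_inv_iff.2 (Or.inr (by
      rw [uIcc_of_le hab]
      exact fun h => absurd h.1 (not_le.2 ha)))
  rw [← integral_inv_of_pos ha (ha.trans_le hab), intervalIntegral.integral_of_le hab,
    ofReal_integral_eq_lintegral_ofReal hi.1]
  · refine setLIntegral_congr_fun measurableSet_Ioc fun r hr => ?_
    have := hpos r hr
    rw [← ENNReal.ofReal_pow (by positivity), ← ENNReal.ofReal_mul this.le]
    congr 1
    field_simp
  · filter_upwards [ae_restrict_mem measurableSet_Ioc] with r hr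
    exact (inv_pos.2 (hpos r hr)).le

lemma pd_contDiff {n m : WithTop ℕ∞} {f : Pt2 → ℝ} (hf : ContDiff ℝ n f) (hmn : m + 1 ≤ n)
    (j : Fin 2) : ContDiff ℝ m (pd j f) :=
  (hf.fderiv_right hmn).clm_apply contDiff_const

lemma fderiv_apply_eq_sum_pd (f : Pt2 → ℝ) (y v : Pt2) :
    fderiv ℝ f y v = ∑ j, v j * pd j f y := by
  have hv : v = ∑ j, v j • EuclideanSpace.single j (1 : ℝ) := by
    ext i
    fin_cases i <;> simp
  conv_lhs => rw [hv]
  simp [pd]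

lemma hasDerivAt_comp_ray {f : Pt2 → ℝ} (hf : Differentiable ℝ f) (x v : Pt2) (r : ℝ) :
    HasDerivAt (fun s : ℝ => f (x + s • v)) (∑ j, v j * pd j f (x + r • v)) r := by
  rw [← fderiv_apply_eq_sum_pd]
  have h : HasDerivAt (fun s : ℝ => x + s • v) v r := by
    simpa using ((hasDerivAt_id r).smul_const v).const_add x
  exact (hf _).hasFDerivAt.comp_hasDerivAt r h

lemma sq_sum_mul_le {v : Pt2} (hv : ‖v‖ = 1) (a : Fin 2 → ℝ) :
    (∑ j, v j * a j) ^ 2 ≤ ∑ j, a j ^ 2 := by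
  have h1 : ∑ j, v j ^ 2 = 1 := by
    rw [← EuclideanSpace.real_norm_sq_eq, hv, one_pow]
  simpa [h1] using Finset.sum_mul_sq_le_sq_mul_sq Finset.univ (fun j => v j) a

lemma enorm_le_ofReal_sqrt {y s : ℝ} (h : y ^ 2 ≤ s) : ‖y‖ₑ ≤ ENNReal.ofReal (Real.sqrt s) := by
  rw [Real.enorm_eq_ofReal_abs]
  exact ENNReal.ofReal_le_ofReal (Real.abs_le_sqrt h)

lemma enorm_le_weighted_lintegrals_ray {f : Pt2 → ℝ} (hf : ContDiff ℝ 2 f) (x : Pt2) {v : Pt2}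
    (hv : ‖v‖ = 1) {ε R : ℝ} (hε : 0 < ε) (hεR : ε ≤ R) :
    ‖f x‖ₑ ≤ (∫⁻ r in Ioc 0 ε,
          ENNReal.ofReal r * (ENNReal.ofReal (2 / ε) * ‖gradNorm f (x + r • v)‖ₑ))
      + (∫⁻ r in Ioc 0 ε, ENNReal.ofReal r * (ENNReal.ofReal 1 * ‖hessNorm f (x + r • v)‖ₑ))
      + (∫⁻ r in Ioc ε R, ENNReal.ofReal r * (ENNReal.ofReal r⁻¹ * ‖gradNorm f (x + r • v)‖ₑ))
      + ∫⁻ r in Ioc 0 R,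
          ENNReal.ofReal r * (ENNReal.ofReal (2 / R ^ 2) * ‖f (x + r • v)‖ₑ) := by
  have hpd : ∀ j, ContDiff ℝ 1 (pd j f) := pd_contDiff hf (by norm_num)
  have hpd2 : ∀ j i, Continuous (pd i (pd j f)) := fun j i =>
    (pd_contDiff (m := 0) (hpd j) (by norm_num) i).continuous
  have key := enorm_zero_le_weighted_lintegrals
    (g := fun r : ℝ => f (x + r • v)) (g₁ := fun r => ∑ j, v j * pd j f (x + r • v))
    (g₂ := fun r => ∑ j, v j * ∑ i, v i * pd i (pd j f) (x + r • v))
    (G₀ := fun r => ‖f (x + r • v)‖ₑ) (G₁ := fun r => ‖gradNorm f (x + r • v)‖ₑ)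
    (G₂ := fun r => ‖hessNorm f (x + r • v)‖ₑ)
    (hasDerivAt_comp_ray (hf.differentiable (by norm_num)) x v)
    (fun r => HasDerivAt.fun_sum fun j _ =>
      (hasDerivAt_comp_ray ((hpd j).differentiable (by norm_num)) x v r).const_mul _)
    (by fun_prop) (fun _ => le_rfl) (fun r => ?_) (fun r => ?_) hε hεR
  · simpa using key
  · rw [gradNorm, Real.enorm_of_nonneg (Real.sqrt_nonneg _)]
    exact enorm_le_ofReal_sqrt (sq_sum_mul_le hv _)
  · rw [hessNorm, Real.enorm_of_nonneg (Real.sqrt_nonneg _)]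
    refine enorm_le_ofReal_sqrt ((sq_sum_mul_le hv _).trans ?_)
    rw [Finset.sum_comm]
    exact Finset.sum_le_sum fun j _ => sq_sum_mul_le hv _

lemma rpow_lintegral_translate_eq_eLpNorm (F : Pt2 → ℝ) (x : Pt2) :
    (∫⁻ y, ‖F (x + y)‖ₑ ^ (2 : ℝ)) ^ (1 / 2 : ℝ) = eLpNorm F 2 volume := by
  rw [lintegral_add_left_eq_self (fun y => ‖F y‖ₑ ^ (2 : ℝ)) x,
    eLpNorm_eq_lintegral_rpow_enorm_toReal two_ne_zero ENNReal.ofNat_ne_top]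
  simp

/-- A pointwise bound on a `C²` function on the plane with two free length scales. -/
lemma enorm_le_of_scales {f : Pt2 → ℝ} (hf : ContDiff ℝ 2 f) (x : Pt2) {ε R : ℝ}
    (hε : 0 < ε) (hεR : ε ≤ R) :
    ENNReal.ofReal (2 * Real.pi) * ‖f x‖ₑ ≤
      ENNReal.ofReal (Real.sqrt (2 * Real.pi * (ε ^ 2 * (2 / ε) ^ 2))) * eLpNorm (gradNorm f) 2 volume
      + ENNReal.ofReal (Real.sqrt (2 * Real.pi * (ε ^ 2 * 1 ^ 2))) * eLpNorm (hessNorm f) 2 volume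
      + ENNReal.ofReal (Real.sqrt (2 * Real.pi * Real.log (R / ε))) * eLpNorm (gradNorm f) 2 volume
      + ENNReal.ofReal (Real.sqrt (2 * Real.pi * (R ^ 2 * (2 / R ^ 2) ^ 2)))
        * eLpNorm f 2 volume := by
  have hR : 0 < R := hε.trans_le hεR
  have hpd : ∀ j, ContDiff ℝ 1 (pd j f) := pd_contDiff hf (by norm_num)
  have hpd1 : ∀ j, Continuous (pd j f) := fun j => (hpd j).continuous
  have hpd2 : ∀ i j, Continuous (pd i (pd j f)) := fun i j =>
    (pd_contDiff (m := 0) (hpd j) (by norm_num) i).continuous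
  have c₀ : Continuous f := hf.continuous
  have c₁ : Continuous (gradNorm f) := by unfold gradNorm; fun_prop
  have c₂ : Continuous (hessNorm f) := by unfold hessNorm; fun_prop
  have m₀ : Measurable fun y => ‖f (x + y)‖ₑ :=
    (c₀.comp (continuous_const.add continuous_id)).enorm.measurable
  have m₁ : Measurable fun y => ‖gradNorm f (x + y)‖ₑ :=
    (c₁.comp (continuous_const.add continuous_id)).enorm.measurable
  have m₂ : Measurable fun y => ‖hessNorm f (x + y)‖ₑ :=
    (c₂.comp (continuous_const.add continuous_id)).enorm.measurable
  have meas : ∀ {w : ℝ → ℝ} {F : Pt2 → ℝ≥0∞} (s : Set ℝ), Measurable w → Measurable F →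
      Measurable fun θ : Metric.sphere (0 : Pt2) 1 =>
        ∫⁻ r in s, ENNReal.ofReal r * (ENNReal.ofReal (w r) * F (r • (θ : Pt2))) := by
    intro w F s hw hF
    refine Measurable.lintegral_prod_right' (f := fun p : Metric.sphere (0 : Pt2) 1 × ℝ =>
      ENNReal.ofReal p.2 * (ENNReal.ofReal (w p.2) * F (p.2 • (p.1 : Pt2)))) ?_
    fun_prop
  calc ENNReal.ofReal (2 * Real.pi) * ‖f x‖ₑ
      = ∫⁻ _, ‖f x‖ₑ ∂(volume : Measure Pt2).toSphere := by
        rw [lintegral_const, toSphere_univ_plane, mul_comm]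
    _ ≤ _ := lintegral_mono fun θ =>
        enorm_le_weighted_lintegrals_ray hf x (norm_eq_of_mem_sphere θ) hε hεR
    _ = _ := by
        rw [lintegral_add_right _ (meas _ measurable_const m₀),
          lintegral_add_right _ (meas _ measurable_inv m₁),
          lintegral_add_right _ (meas _ measurable_const m₂)]
    _ ≤ _ := by
        gcongr
        · exact lintegral_shell_mul_le le_rfl measurable_const m₁
            (lintegral_Ioc_const_weight_le hε.le (by positivity))
            (rpow_lintegral_translate_eq_eLpNorm _ x).le
        · exact lintegral_shell_mul_le le_rfl measurable_const m₂
            (lintegral_Ioc_const_weight_le hε.le (by positivity))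
            (rpow_lintegral_translate_eq_eLpNorm _ x).le
        · exact lintegral_shell_mul_le hε.le measurable_inv m₁
            (lintegral_Ioc_inv_weight hε hεR).le
            (rpow_lintegral_translate_eq_eLpNorm _ x).le
        · exact lintegral_shell_mul_le le_rfl measurable_const m₀
            (lintegral_Ioc_const_weight_le hR.le (by positivity))
            (rpow_lintegral_translate_eq_eLpNorm _ x).le

theorem log_sobolev_plane :
    ∃ C : ℝ, 0 < C ∧
      ∀ f : Pt2 → ℝ, ContDiff ℝ 2 f →
      ∀ t : ℝ, 0 ≤ t →
        eLpNorm f ⊤ volume ≤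
          ENNReal.ofReal C *
            (eLpNorm (gradNorm f) 2 volume
                * ENNReal.ofReal (Real.sqrt (Real.log (Real.exp 1 + t)))
              + ENNReal.ofReal (1 / (1 + t)) *
                (eLpNorm f 2 volume + eLpNorm (hessNorm f) 2 volume)) := by
  refine ⟨12, by norm_num, fun f hf t ht => ?_⟩
  rw [eLpNorm_exponent_top]
  refine eLpNormEssSup_le_of_ae_enorm_bound (Filter.Eventually.of_forall fun x => ?_)
  set T : ℝ := Real.exp 1 + t with hT
  have he : (2 : ℝ) ≤ Real.exp 1 := by linarith [Real.add_one_le_exp (1 : ℝ)]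
  have hT1 : 1 + t ≤ T := by linarith
  have hT0 : 0 < T := by linarith
  have hL : 1 ≤ Real.log T := by
    rw [Real.le_log_iff_exp_le hT0]
    linarith
  have hπ := Real.pi_pos
  have hπ4 := Real.pi_le_four
  have hinv : 1 / T ≤ 1 / (1 + t) := one_div_le_one_div_of_le (by linarith) hT1
  have hεT : 1 / T ≤ T := by
    rw [div_le_iff₀ hT0]
    nlinarith
  have key := enorm_le_of_scales hf x (one_div_pos.2 hT0) hεT
  have k₁ : Real.sqrt (2 * Real.pi * ((1 / T) ^ 2 * (2 / (1 / T)) ^ 2))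
      ≤ 6 * Real.sqrt (Real.log T) := by
    rw [Real.sqrt_le_left (by positivity), mul_pow, Real.sq_sqrt (by linarith)]
    field_simp
    nlinarith
  have k₂ : Real.sqrt (2 * Real.pi * ((1 / T) ^ 2 * 1 ^ 2)) ≤ 12 * (1 / (1 + t)) := by
    refine le_trans ?_ (mul_le_mul_of_nonneg_left hinv (by norm_num))
    rw [Real.sqrt_le_left (by positivity), mul_pow]
    nlinarith [sq_nonneg (1 / T)]
  have k₃ : Real.sqrt (2 * Real.pi * Real.log (T / (1 / T))) ≤ 6 * Real.sqrt (Real.log T) := by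
    have : Real.log (T / (1 / T)) = 2 * Real.log T := by
      rw [div_div_eq_mul_div, div_one, Real.log_mul hT0.ne' hT0.ne']
      ring
    rw [Real.sqrt_le_left (by positivity), mul_pow, Real.sq_sqrt (by linarith), this]
    nlinarith
  have k₄ : Real.sqrt (2 * Real.pi * (T ^ 2 * (2 / T ^ 2) ^ 2)) ≤ 12 * (1 / (1 + t)) := by
    refine le_trans ?_ (mul_le_mul_of_nonneg_left hinv (by norm_num))
    have : T ^ 2 * (2 / T ^ 2) ^ 2 = 4 * (1 / T) ^ 2 := by
      field_simp
      norm_num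
    rw [Real.sqrt_le_left (by positivity), mul_pow, this]
    nlinarith [sq_nonneg (1 / T)]
  have hone : ‖f x‖ₑ ≤ ENNReal.ofReal (2 * Real.pi) * ‖f x‖ₑ :=
    le_mul_of_one_le_left' (ENNReal.one_le_ofReal.2 (by linarith [Real.pi_gt_three]))
  refine (hone.trans key).trans ?_
  calc _ ≤ ENNReal.ofReal (6 * Real.sqrt (Real.log T)) * eLpNorm (gradNorm f) 2 volume
      + ENNReal.ofReal (12 * (1 / (1 + t))) * eLpNorm (hessNorm f) 2 volume
      + ENNReal.ofReal (6 * Real.sqrt (Real.log T)) * eLpNorm (gradNorm f) 2 volume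
      + ENNReal.ofReal (12 * (1 / (1 + t))) * eLpNorm f 2 volume := by gcongr
    _ = _ := by
      rw [ENNReal.ofReal_mul (by norm_num), ENNReal.ofReal_mul (by norm_num),
        show ENNReal.ofReal 12 = 12 by simp, show ENNReal.ofReal 6 = 6 by simp]
      ring

end Stmt7
end
end

section
/- There is a constant C > 0 (independent of δ, t and f) such that for every 0 < δ ≤ 1, every t ≥ 1, and every smooth f defined on ℝ × Ω_δ (periodic in x₃) with f(t,·) ∈ H⁴(Ω_δ), one has t (ln(e+t))^{−1/2} ‖∇f(t,·)‖_{L^∞({r ≤ t/2})} ≤ C [ δ^{−1/2} ‖(t−r)∇²f(t,·)‖_{L²(Ω_δ)} + δ^{1/2} ‖(t−r)∂₃∂_v∇f(t,·)‖_{L²(Ω_δ)} + δ^{−1/2} Σ_{|a|≤2} ‖∇Z^a f(t,·)‖_{L²(Ω_δ)} + δ^{1/2} Σ_{|a|≤2} ‖∇²Z^a f(t,·)‖_{L²(Ω_δ)} ], where Z^a ranges over words of length |a| ≤ 2 in the operators {∂_t, ∂₁, ∂₂, Ω̃₁, Ω̃₂, Ω̃₃, S̃}, provided the right-hand side is finite.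 -/
/-!
STATEMENT 8: Interior decay estimate away from the light cone (Lemma K-S-O):
for t ≥ 1,
t (ln(e+t))^{-1/2} ‖∇f(t,·)‖_{L∞(r ≤ t/2)}
  ≤ C [ δ^{-1/2} ‖(t−r)∇²f(t)‖_{L²(Ω_δ)} + δ^{1/2} ‖(t−r)∂₃∂_v∇f(t)‖_{L²(Ω_δ)}
       + δ^{-1/2} Σ_{|a|≤2} ‖∇Z^a f(t)‖_{L²(Ω_δ)} + δ^{1/2} Σ_{|a|≤2} ‖∇²Z^a f(t)‖_{L²(Ω_δ)} ].
-/

noncomputable section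
open MeasureTheory
open scoped ENNReal

namespace Stmt8

abbrev Pt : Type := EuclideanSpace ℝ (Fin 3)

abbrev STF : Type := ℝ → Pt → ℝ

def e3 : Pt := EuclideanSpace.single 2 1

def slab (δ : ℝ) : Set Pt := {x : Pt | x 2 ∈ Set.Ico 0 δ}

def pd (j : Fin 3) (f : Pt → ℝ) : Pt → ℝ :=
  fun x => fderiv ℝ f x (EuclideanSpace.single j 1)

def L2 (δ : ℝ) (f : Pt → ℝ) : ℝ≥0∞ := eLpNorm f 2 (volume.restrict (slab δ))

/-- Time derivative ∂_t. -/
def Dt (f : STF) : STF := fun t x => deriv (fun s => f s x) t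

/-- Spatial derivative ∂_j. -/
def Dsp (j : Fin 3) (f : STF) : STF := fun t x => pd j (f t) x

/-- The rotation operators Ω = y ∧ ∇ (on scalars Ω̃ = Ω). -/
def Om (i : Fin 3) (f : STF) : STF :=
  fun t x => x (i+1) * Dsp (i+2) f t x - x (i+2) * Dsp (i+1) f t x

/-- The scaling operator S = t∂_t + r∂_r. -/
def Sc (f : STF) : STF := fun t x => t * Dt f t x + ∑ j, x j * Dsp j f t x

/-- The modified scaling S̃ = S − 1 (on scalars). -/
def ScT (f : STF) : STF := fun t x => Sc f t x - f t x

/-- Z^a = ∂_t^{a₁} ∂₁^{a₂} ∂₂^{a₃} Ω̃₁^{a₄} Ω̃₂^{a₅} Ω̃₃^{a₆} S̃^{a₇} for a ∈ ℕ⁷. -/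
def Za (a : Fin 7 → ℕ) : STF → STF :=
  Dt^[a 0] ∘ (Dsp 0)^[a 1] ∘ (Dsp 1)^[a 2]
    ∘ (Om 0)^[a 3] ∘ (Om 1)^[a 4] ∘ (Om 2)^[a 5] ∘ ScT^[a 6]

/-- Multi-indices a ∈ ℕ⁷ with |a| ≤ n. -/
def idx7 (n : ℕ) : Finset (Fin 7 → ℕ) :=
  (Fintype.piFinset fun _ => Finset.range (n+1)).filter fun a => ∑ i, a i ≤ n

lemma enorm_sq_eq_ofReal (a : ℝ) : ‖a‖ₑ ^ 2 = ENNReal.ofReal (a ^ 2) := by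
  rw [← ofReal_norm, ← ENNReal.ofReal_pow (norm_nonneg a), Real.norm_eq_abs, sq_abs]

lemma enorm_add_sq_le (a b : ℝ) : ‖a + b‖ₑ ^ 2 ≤ 2 * ‖a‖ₑ ^ 2 + 2 * ‖b‖ₑ ^ 2 := by
  simp only [enorm_sq_eq_ofReal]
  rw [← ENNReal.ofReal_ofNat 2, ← ENNReal.ofReal_mul (by norm_num),
    ← ENNReal.ofReal_mul (by norm_num), ← ENNReal.ofReal_add (by positivity) (by positivity)]
  exact ENNReal.ofReal_le_ofReal (by nlinarith [sq_nonneg (a - b)])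

lemma lintegral_mul_sq_le {α : Type*} [MeasurableSpace α] (μ : Measure α) {f g : α → ℝ≥0∞}
    (hf : AEMeasurable f μ) (hg : AEMeasurable g μ) :
    (∫⁻ x, f x * g x ∂μ) ^ 2 ≤ (∫⁻ x, f x ^ 2 ∂μ) * ∫⁻ x, g x ^ 2 ∂μ := by
  have h := ENNReal.lintegral_mul_le_Lp_mul_Lq μ Real.HolderConjugate.two_two hf hg
  have h2 := pow_le_pow_left' h 2
  simp only [Pi.mul_apply, ENNReal.rpow_two] at h2
  refine h2.trans_eq ?_
  rw [mul_pow, ← ENNReal.rpow_natCast, ← ENNReal.rpow_natCast, ← ENNReal.rpow_mul,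
    ← ENNReal.rpow_mul]
  norm_num

lemma enorm_sub_le_lintegral_deriv {φ φ' : ℝ → ℝ} (hφ : ∀ x, HasDerivAt φ (φ' x) x)
    (hc : Continuous φ') {lo hi a b : ℝ} (ha : a ∈ Set.Icc lo hi) (hb : b ∈ Set.Icc lo hi) :
    ‖φ b - φ a‖ₑ ≤ ∫⁻ x in Set.Icc lo hi, ‖φ' x‖ₑ := by
  wlog hab : a ≤ b generalizing a b
  · rw [enorm_sub_rev]
    exact this hb ha (le_of_not_ge hab)
  rw [← intervalIntegral.integral_eq_sub_of_hasDerivAt (fun x _ => hφ x)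
    (hc.intervalIntegrable a b), intervalIntegral.integral_of_le hab]
  exact (enorm_integral_le_lintegral_enorm _).trans (lintegral_mono_set
    (Set.Ioc_subset_Icc_self.trans (Set.Icc_subset_Icc ha.1 hb.2)))

lemma enorm_sub_sq_le {φ φ' : ℝ → ℝ} (hφ : ∀ x, HasDerivAt φ (φ' x) x)
    (hc : Continuous φ') {lo hi a b : ℝ} (ha : a ∈ Set.Icc lo hi) (hb : b ∈ Set.Icc lo hi) :
    ‖φ b - φ a‖ₑ ^ 2 ≤ ENNReal.ofReal (hi - lo) * ∫⁻ x in Set.Icc lo hi, ‖φ' x‖ₑ ^ 2 := by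
  refine (pow_le_pow_left' (enorm_sub_le_lintegral_deriv hφ hc ha hb) 2).trans ?_
  have := lintegral_mul_sq_le (volume.restrict (Set.Icc lo hi)) (f := fun _ => 1)
    (g := fun x => ‖φ' x‖ₑ) aemeasurable_const hc.measurable.enorm.aemeasurable
  simpa using this

/-- Pointwise bound by an average plus a derivative, in one variable. -/
lemma enorm_sq_le_average {φ φ' : ℝ → ℝ} (hφ : ∀ x, HasDerivAt φ (φ' x) x)
    (hc : Continuous φ') {lo hi m z : ℝ} (hm : m ∈ Set.Ico lo hi) (hz : z ∈ Set.Icc lo hi) :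
    ‖φ z‖ₑ ^ 2 ≤ ENNReal.ofReal (2 / (hi - m)) * (∫⁻ x in Set.Icc m hi, ‖φ x‖ₑ ^ 2)
      + ENNReal.ofReal (2 * (hi - lo)) * ∫⁻ x in Set.Icc lo hi, ‖φ' x‖ₑ ^ 2 := by
  have hφc : Continuous φ := continuous_iff_continuousAt.2 fun x => (hφ x).continuousAt
  have hpos : 0 < hi - m := by linarith [hm.2]
  set D := ∫⁻ x in Set.Icc lo hi, ‖φ' x‖ₑ ^ 2
  have key : ∀ x ∈ Set.Icc m hi,
      ‖φ z‖ₑ ^ 2 ≤ 2 * ‖φ x‖ₑ ^ 2 + 2 * (ENNReal.ofReal (hi - lo) * D) := by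
    intro x hx
    have h1 := enorm_add_sq_le (φ x) (φ z - φ x)
    rw [add_sub_cancel] at h1
    refine h1.trans ?_
    gcongr
    exact enorm_sub_sq_le hφ hc ⟨hm.1.trans hx.1, hx.2⟩ hz
  have h2 := setLIntegral_mono (μ := volume)
    (((hφc.measurable.enorm.pow_const 2).const_mul 2).add_const _) key
  rw [setLIntegral_const, lintegral_add_right _ measurable_const, setLIntegral_const,
    lintegral_const_mul _ (hφc.measurable.enorm.pow_const 2), Real.volume_Icc] at h2
  have h0 : ENNReal.ofReal (hi - m) ≠ 0 := by simpa using hpos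
  have e1 : ENNReal.ofReal (2 / (hi - m)) = 2 / ENNReal.ofReal (hi - m) := by
    rw [ENNReal.ofReal_div_of_pos hpos, ENNReal.ofReal_ofNat]
  have e2 : ENNReal.ofReal (2 * (hi - lo)) = 2 * ENNReal.ofReal (hi - lo) := by
    rw [ENNReal.ofReal_mul (by norm_num), ENNReal.ofReal_ofNat]
  rw [e1, e2, ← ENNReal.mul_le_mul_iff_left h0 ENNReal.ofReal_ne_top]
  refine h2.trans_eq ?_
  rw [add_mul, ENNReal.div_eq_inv_mul]
  have : (ENNReal.ofReal (hi - m))⁻¹ * ENNReal.ofReal (hi - m) = 1 :=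
    ENNReal.inv_mul_cancel h0 ENNReal.ofReal_ne_top
  calc _ = ((ENNReal.ofReal (hi - m))⁻¹ * ENNReal.ofReal (hi - m)) *
        (2 * ∫⁻ x in Set.Icc m hi, ‖φ x‖ₑ ^ 2) + _ := by rw [this, one_mul]
    _ = _ := by ring

lemma lintegral_Icc_inv {s R : ℝ} (hs : 0 < s) (hsR : s ≤ R) :
    ∫⁻ x in Set.Icc s R, ENNReal.ofReal x⁻¹ = ENNReal.ofReal (Real.log (R / s)) := by
  rw [← integral_inv_of_pos hs (hs.trans_le hsR), intervalIntegral.integral_of_le hsR,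
    ← integral_Icc_eq_integral_Ioc, ofReal_integral_eq_lintegral_ofReal]
  · refine ContinuousOn.integrableOn_Icc (continuousOn_inv₀.mono fun x hx => ?_)
    exact (hs.trans_le hx.1).ne'
  · filter_upwards [ae_restrict_mem measurableSet_Icc] with x hx
    exact inv_nonneg.2 (hs.trans_le hx.1).le

/-- The logarithmic comparison of the values of a function at two scales. -/
lemma enorm_sq_le_log {φ φ' : ℝ → ℝ} (hφ : ∀ x, HasDerivAt φ (φ' x) x)
    (hc : Continuous φ') {s R : ℝ} (hs : 0 < s) (hsR : s ≤ R) :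
    ‖φ s‖ₑ ^ 2 ≤ 2 * ‖φ R‖ₑ ^ 2 + 2 * (ENNReal.ofReal (Real.log (R / s)) *
      ∫⁻ x in Set.Icc s R, ENNReal.ofReal x * ‖φ' x‖ₑ ^ 2) := by
  have h1 := enorm_add_sq_le (φ R) (φ s - φ R)
  rw [add_sub_cancel] at h1
  refine h1.trans ?_
  gcongr
  refine (pow_le_pow_left' (enorm_sub_le_lintegral_deriv hφ hc (lo := s) (hi := R)
    ⟨hsR, le_rfl⟩ ⟨le_rfl, hsR⟩) 2).trans ?_
  have h2 := lintegral_mul_sq_le (volume.restrict (Set.Icc s R))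
    (f := fun x => ENNReal.ofReal √x⁻¹) (g := fun x => ENNReal.ofReal √x * ‖φ' x‖ₑ)
    (by fun_prop) (by have := hc.measurable; fun_prop)
  rw [← lintegral_Icc_inv hs hsR]
  refine le_trans (le_of_eq ?_) (h2.trans_eq ?_)
  · congr 1
    refine setLIntegral_congr_fun measurableSet_Icc fun x hx => ?_
    have hx0 : 0 < x := hs.trans_le hx.1
    rw [← mul_assoc, ← ENNReal.ofReal_mul (Real.sqrt_nonneg _), ← Real.sqrt_mul (by positivity),
      inv_mul_cancel₀ hx0.ne']
    simp
  · congr 1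
    · refine setLIntegral_congr_fun measurableSet_Icc fun x hx => ?_
      have hx0 : 0 < x := hs.trans_le hx.1
      rw [← ENNReal.ofReal_pow (Real.sqrt_nonneg _), Real.sq_sqrt (by positivity)]
    · refine setLIntegral_congr_fun measurableSet_Icc fun x hx => ?_
      have hx0 : 0 < x := hs.trans_le hx.1
      rw [mul_pow, ← ENNReal.ofReal_pow (Real.sqrt_nonneg _), Real.sq_sqrt hx0.le]

lemma ofReal_mul_setLIntegral_comp_mul {F : ℝ → ℝ≥0∞} (hF : Measurable F) {c : ℝ} (hc : 0 < c)
    (lo hi : ℝ) :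
    ENNReal.ofReal c * ∫⁻ x in Set.Icc lo hi, F (c * x) = ∫⁻ y in Set.Icc (c * lo) (c * hi), F y := by
  conv_rhs => rw [← Real.smul_map_volume_mul_left hc.ne', Measure.restrict_smul,
    lintegral_smul_measure, setLIntegral_map measurableSet_Icc hF (measurable_const_mul c),
    Set.preimage_const_mul_Icc₀ _ _ hc]
  rw [mul_div_cancel_left₀ _ hc.ne', mul_div_cancel_left₀ _ hc.ne', abs_of_pos hc, smul_eq_mul]

lemma lintegral_rays_le {G : ℝ → ℝ → ℝ≥0∞} (hG : Measurable (Function.uncurry G)) {s R : ℝ}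
    (hs : 0 < s) :
    ∫⁻ x in Set.Icc (1 : ℝ) 2, ∫⁻ y in Set.Icc (1 : ℝ) 2, ∫⁻ l in Set.Icc s R,
        ENNReal.ofReal l * G (l * x) (l * y)
      ≤ ∫⁻ x in Set.Icc 0 (2 * R), ∫⁻ y in Set.Icc 0 (2 * R), G x y := by
  set H : ℝ → ℝ≥0∞ := fun x => ∫⁻ y in Set.Icc 0 (2 * R), G x y with hH
  have hHm : Measurable H := hG.lintegral_prod_right
  have key : ∀ x ∈ Set.Icc (1 : ℝ) 2, ∫⁻ y in Set.Icc (1 : ℝ) 2, ∫⁻ l in Set.Icc s R,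
      ENNReal.ofReal l * G (l * x) (l * y) ≤ ∫⁻ x in Set.Icc 0 (2 * R), H x := by
    intro x hx
    have hx0 : (0 : ℝ) < x := by linarith [hx.1]
    rw [lintegral_lintegral_swap]
    · calc _ ≤ ∫⁻ l in Set.Icc s R, H (x * l) := by
            refine setLIntegral_mono (hHm.comp (measurable_const_mul x)) fun l hl => ?_
            have hl0 : 0 < l := hs.trans_le hl.1
            have hm : Measurable (G (l * x)) := hG.comp measurable_prodMk_left
            rw [lintegral_const_mul' _ _ ENNReal.ofReal_ne_top,
              ofReal_mul_setLIntegral_comp_mul hm hl0, mul_comm x l]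
            refine lintegral_mono_set (Set.Icc_subset_Icc ?_ ?_)
            · positivity
            · linarith [hl.2]
        _ ≤ ENNReal.ofReal x * ∫⁻ l in Set.Icc s R, H (x * l) := by
            refine le_mul_of_one_le_left' ?_
            simpa using hx.1
        _ ≤ _ := by
            rw [ofReal_mul_setLIntegral_comp_mul hHm hx0]
            by_cases hR : 0 ≤ R
            · exact lintegral_mono_set (Set.Icc_subset_Icc (by positivity)
                (mul_le_mul_of_nonneg_right hx.2 hR))
            · rw [Set.Icc_eq_empty]
              · simp
              · nlinarith
    · have : Measurable fun p : ℝ × ℝ => G (p.2 * x) (p.2 * p.1) :=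
        hG.comp ((measurable_snd.mul_const x).prodMk (measurable_snd.mul measurable_fst))
      exact (Measurable.mul (by fun_prop) this).aemeasurable
  refine (setLIntegral_mono measurable_const key).trans_eq ?_
  rw [setLIntegral_const, Real.volume_Icc]
  norm_num

/-- Pointwise bound by an average and the mixed derivative, in two variables. -/
lemma enorm_sq_le_average_two {h h₁ h₂ h₁₂ : ℝ → ℝ → ℝ} (hc : Continuous (Function.uncurry h))
    (hc₁ : Continuous (Function.uncurry h₁)) (hc₂ : Continuous (Function.uncurry h₂))
    (hc₁₂ : Continuous (Function.uncurry h₁₂))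
    (d₁ : ∀ x y, HasDerivAt (fun a => h a y) (h₁ x y) x)
    (d₂ : ∀ x y, HasDerivAt (fun b => h x b) (h₂ x y) y)
    (d₁₂ : ∀ x y, HasDerivAt (fun b => h₁ x b) (h₁₂ x y) y) {s : ℝ} (hs : 0 < s) :
    ‖h 0 0‖ₑ ^ 2 ≤
      ENNReal.ofReal (4 / s ^ 2) *
        (∫⁻ x in Set.Icc s (2 * s), ∫⁻ y in Set.Icc s (2 * s), ‖h x y‖ₑ ^ 2)
      + 8 * (∫⁻ x in Set.Icc 0 (2 * s), ∫⁻ y in Set.Icc 0 (2 * s), ‖h₂ x y‖ₑ ^ 2)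
      + 8 * (∫⁻ x in Set.Icc 0 (2 * s), ∫⁻ y in Set.Icc 0 (2 * s), ‖h₁ x y‖ₑ ^ 2)
      + ENNReal.ofReal (16 * s ^ 2) *
        (∫⁻ x in Set.Icc 0 (2 * s), ∫⁻ y in Set.Icc 0 (2 * s), ‖h₁₂ x y‖ₑ ^ 2) := by
  have m : ∀ {g : ℝ → ℝ → ℝ}, Continuous (Function.uncurry g) → ∀ S : Set ℝ,
      Measurable fun x => ∫⁻ y in S, ‖g x y‖ₑ ^ 2 := fun hg S =>
    Measurable.lintegral_prod_right (f := fun x y => ‖_‖ₑ ^ 2) (hg.measurable.enorm.pow_const 2)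
  have hlo : s ∈ Set.Ico 0 (2 * s) := ⟨hs.le, by linarith⟩
  have hz : (0 : ℝ) ∈ Set.Icc 0 (2 * s) := ⟨le_rfl, by linarith⟩
  have e1 : (2 * s - s) = s := by ring
  have e2 : 2 * (2 * s - 0) = 4 * s := by ring
  have b0 := enorm_sq_le_average (φ := fun a => h a 0) (fun x => d₁ x 0)
    (hc₁.comp (by fun_prop : Continuous fun x : ℝ => (x, (0 : ℝ)))) hlo hz
  have bh : ∀ x, _ := fun x => enorm_sq_le_average (φ := fun b => h x b) (fun y => d₂ x y)
    (hc₂.comp (by fun_prop : Continuous fun y : ℝ => (x, y))) hlo hz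
  have bh₁ : ∀ x, _ := fun x => enorm_sq_le_average (φ := fun b => h₁ x b) (fun y => d₁₂ x y)
    (hc₁₂.comp (by fun_prop : Continuous fun y : ℝ => (x, y))) hlo hz
  simp only [e1, e2] at b0 bh bh₁
  refine b0.trans ?_
  have i1 : ∫⁻ x in Set.Icc s (2 * s), ‖h x 0‖ₑ ^ 2 ≤
      ENNReal.ofReal (2 / s) *
        (∫⁻ x in Set.Icc s (2 * s), ∫⁻ y in Set.Icc s (2 * s), ‖h x y‖ₑ ^ 2) +
      ENNReal.ofReal (4 * s) *
        (∫⁻ x in Set.Icc 0 (2 * s), ∫⁻ y in Set.Icc 0 (2 * s), ‖h₂ x y‖ₑ ^ 2) := by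
    refine (lintegral_mono fun x => bh x).trans ?_
    rw [lintegral_add_left ((m hc _).const_mul _), lintegral_const_mul _ (m hc _),
      lintegral_const_mul _ (m hc₂ _)]
    gcongr
  have i2 : ∫⁻ x in Set.Icc 0 (2 * s), ‖h₁ x 0‖ₑ ^ 2 ≤
      ENNReal.ofReal (2 / s) *
        (∫⁻ x in Set.Icc 0 (2 * s), ∫⁻ y in Set.Icc 0 (2 * s), ‖h₁ x y‖ₑ ^ 2) +
      ENNReal.ofReal (4 * s) *
        (∫⁻ x in Set.Icc 0 (2 * s), ∫⁻ y in Set.Icc 0 (2 * s), ‖h₁₂ x y‖ₑ ^ 2) := by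
    refine (lintegral_mono fun x => bh₁ x).trans ?_
    rw [lintegral_add_left ((m hc₁ _).const_mul _), lintegral_const_mul _ (m hc₁ _),
      lintegral_const_mul _ (m hc₁₂ _)]
    gcongr
  refine (add_le_add (mul_le_mul_right i1 _) (mul_le_mul_right i2 _)).trans_eq ?_
  have c1 : ENNReal.ofReal (2 / s) * ENNReal.ofReal (2 / s) = ENNReal.ofReal (4 / s ^ 2) := by
    rw [← ENNReal.ofReal_mul (by positivity)]; congr 1; field_simp; norm_num
  have c2 : ENNReal.ofReal (2 / s) * ENNReal.ofReal (4 * s) = 8 := by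
    rw [← ENNReal.ofReal_mul (by positivity), ← ENNReal.ofReal_ofNat]; congr 1; field_simp; norm_num
  have c3 : ENNReal.ofReal (4 * s) * ENNReal.ofReal (4 * s) = ENNReal.ofReal (16 * s ^ 2) := by
    rw [← ENNReal.ofReal_mul (by positivity)]; congr 1; ring
  rw [mul_add, mul_add, ← mul_assoc, ← mul_assoc, ← mul_assoc, ← mul_assoc, c1, c2,
    mul_comm (ENNReal.ofReal (4 * s)) (ENNReal.ofReal (2 / s)), c2, c3]
  ring

lemma enorm_mul_add_mul_sq_le {x y : ℝ} (hx : x ∈ Set.Icc (1 : ℝ) 2) (hy : y ∈ Set.Icc (1 : ℝ) 2)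
    (a b : ℝ) : ‖x * a + y * b‖ₑ ^ 2 ≤ 8 * (‖a‖ₑ ^ 2 + ‖b‖ₑ ^ 2) := by
  simp only [enorm_sq_eq_ofReal]
  rw [← ENNReal.ofReal_add (by positivity) (by positivity), ← ENNReal.ofReal_ofNat 8,
    ← ENNReal.ofReal_mul (by norm_num)]
  refine ENNReal.ofReal_le_ofReal ?_
  have h1 : x ^ 2 ≤ 4 := by nlinarith [hx.1, hx.2]
  have h2 : y ^ 2 ≤ 4 := by nlinarith [hy.1, hy.2]
  nlinarith [sq_nonneg (x * a - y * b), mul_le_mul_of_nonneg_right h1 (sq_nonneg a),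
    mul_le_mul_of_nonneg_right h2 (sq_nonneg b)]

lemma setLIntegral_square_scale {g : ℝ → ℝ → ℝ} (hg : Continuous (Function.uncurry g)) {s : ℝ}
    (hs : 0 < s) :
    ENNReal.ofReal (s ^ 2) *
        ∫⁻ x in Set.Icc (1 : ℝ) 2, ∫⁻ y in Set.Icc (1 : ℝ) 2, ‖g (s * x) (s * y)‖ₑ ^ 2 =
      ∫⁻ x in Set.Icc s (2 * s), ∫⁻ y in Set.Icc s (2 * s), ‖g x y‖ₑ ^ 2 := by
  have m : Measurable fun p : ℝ × ℝ => ‖g p.1 p.2‖ₑ ^ 2 := hg.measurable.enorm.pow_const 2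
  have h1 : ∀ x, ENNReal.ofReal s * ∫⁻ y in Set.Icc (1 : ℝ) 2, ‖g x (s * y)‖ₑ ^ 2
      = ∫⁻ y in Set.Icc s (2 * s), ‖g x y‖ₑ ^ 2 := fun x => by
    rw [ofReal_mul_setLIntegral_comp_mul (F := fun y => ‖g x y‖ₑ ^ 2)
      (m.comp measurable_prodMk_left) hs, mul_one, mul_comm s 2]
  have h2 := ofReal_mul_setLIntegral_comp_mul
    (F := fun x => ∫⁻ y in Set.Icc s (2 * s), ‖g x y‖ₑ ^ 2)
    (Measurable.lintegral_prod_right (f := fun x y => ‖g x y‖ₑ ^ 2) m) hs 1 2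
  rw [mul_one, mul_comm s 2] at h2
  rw [← h2, sq, ENNReal.ofReal_mul hs.le, mul_assoc]
  congr 1
  rw [← lintegral_const_mul']
  · exact lintegral_congr fun x => h1 _
  · exact ENNReal.ofReal_ne_top

/-- A Brezis–Gallouet type inequality on a square, with a logarithmic loss at first order. -/
lemma enorm_sq_le_log_two {h h₁ h₂ h₁₂ : ℝ → ℝ → ℝ} (hc : Continuous (Function.uncurry h))
    (hc₁ : Continuous (Function.uncurry h₁)) (hc₂ : Continuous (Function.uncurry h₂))
    (hc₁₂ : Continuous (Function.uncurry h₁₂))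
    (d₁ : ∀ x y, HasDerivAt (fun a => h a y) (h₁ x y) x)
    (d₂ : ∀ x y, HasDerivAt (fun b => h x b) (h₂ x y) y)
    (d₁₂ : ∀ x y, HasDerivAt (fun b => h₁ x b) (h₁₂ x y) y)
    (dr : ∀ x y l, HasDerivAt (fun l => h (l * x) (l * y))
      (x * h₁ (l * x) (l * y) + y * h₂ (l * x) (l * y)) l)
    {s R : ℝ} (hs : 0 < s) (hsR : s ≤ R) :
    ‖h 0 0‖ₑ ^ 2 ≤
      ENNReal.ofReal (8 / R ^ 2) *
        (∫⁻ x in Set.Icc 0 (2 * R), ∫⁻ y in Set.Icc 0 (2 * R), ‖h x y‖ₑ ^ 2)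
      + ENNReal.ofReal (64 * Real.log (R / s) + 8) *
        (∫⁻ x in Set.Icc 0 (2 * R), ∫⁻ y in Set.Icc 0 (2 * R), (‖h₁ x y‖ₑ ^ 2 + ‖h₂ x y‖ₑ ^ 2))
      + ENNReal.ofReal (16 * s ^ 2) *
        (∫⁻ x in Set.Icc 0 (2 * R), ∫⁻ y in Set.Icc 0 (2 * R), ‖h₁₂ x y‖ₑ ^ 2) := by
  have hR : 0 < R := hs.trans_le hsR
  have hlog : 0 ≤ Real.log (R / s) := Real.log_nonneg ((one_le_div hs).2 hsR)
  have hsub : Set.Icc 0 (2 * s) ⊆ Set.Icc 0 (2 * R) := Set.Icc_subset_Icc le_rfl (by linarith)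
  have mono : ∀ {S T : Set ℝ}, S ⊆ T → ∀ F : ℝ → ℝ → ℝ≥0∞,
      ∫⁻ x in S, ∫⁻ y in S, F x y ≤ ∫⁻ x in T, ∫⁻ y in T, F x y := fun hST F =>
    (lintegral_mono fun x => lintegral_mono_set hST).trans (lintegral_mono_set hST)
  have m : ∀ {g : ℝ → ℝ → ℝ}, Continuous (Function.uncurry g) →
      Measurable fun p : ℝ × ℝ => ‖g p.1 p.2‖ₑ ^ 2 := fun hg => hg.measurable.enorm.pow_const 2
  set G : ℝ → ℝ → ℝ≥0∞ := fun x y => ‖h₁ x y‖ₑ ^ 2 + ‖h₂ x y‖ₑ ^ 2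
  have hG : Measurable (Function.uncurry G) := (m hc₁).add (m hc₂)
  set L := Real.log (R / s)
  have ray : ∀ x ∈ Set.Icc (1 : ℝ) 2, ∀ y ∈ Set.Icc (1 : ℝ) 2, ‖h (s * x) (s * y)‖ₑ ^ 2 ≤
      2 * ‖h (R * x) (R * y)‖ₑ ^ 2 + ENNReal.ofReal (16 * L) *
        ∫⁻ l in Set.Icc s R, ENNReal.ofReal l * G (l * x) (l * y) := by
    intro x hx y hy
    have hcd : Continuous fun l => x * h₁ (l * x) (l * y) + y * h₂ (l * x) (l * y) := by
      have p1 : Continuous fun l => h₁ (l * x) (l * y) :=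
        hc₁.comp (by fun_prop : Continuous fun l : ℝ => (l * x, l * y))
      have p2 : Continuous fun l => h₂ (l * x) (l * y) :=
        hc₂.comp (by fun_prop : Continuous fun l : ℝ => (l * x, l * y))
      fun_prop
    refine (enorm_sq_le_log (φ := fun l => h (l * x) (l * y)) (fun l => dr x y l) hcd hs
      hsR).trans ?_
    refine add_le_add le_rfl ?_
    have e : ENNReal.ofReal (16 * L) = 2 * (ENNReal.ofReal L * 8) := by
      rw [ENNReal.ofReal_mul (by norm_num), ENNReal.ofReal_ofNat,
        show (16 : ℝ≥0∞) = 2 * 8 by norm_num]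
      ring
    rw [e, mul_assoc, mul_assoc]
    refine mul_le_mul_right (mul_le_mul_right ?_ _) _
    rw [← lintegral_const_mul' _ _ (by norm_num)]
    refine lintegral_mono fun l => ?_
    rw [mul_left_comm]
    exact mul_le_mul_right (enorm_mul_add_mul_sq_le hx hy _ _) _
  have mR : Measurable fun p : ℝ × ℝ => ‖h (R * p.1) (R * p.2)‖ₑ ^ 2 :=
    (m hc).comp (by fun_prop : Measurable fun p : ℝ × ℝ => (R * p.1, R * p.2))
  have big : ∫⁻ x in Set.Icc (1 : ℝ) 2, ∫⁻ y in Set.Icc (1 : ℝ) 2, ‖h (s * x) (s * y)‖ₑ ^ 2 ≤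
      2 * (∫⁻ x in Set.Icc (1 : ℝ) 2, ∫⁻ y in Set.Icc (1 : ℝ) 2, ‖h (R * x) (R * y)‖ₑ ^ 2)
      + ENNReal.ofReal (16 * L) *
        ∫⁻ x in Set.Icc (1 : ℝ) 2, ∫⁻ y in Set.Icc (1 : ℝ) 2, ∫⁻ l in Set.Icc s R,
          ENNReal.ofReal l * G (l * x) (l * y) := by
    rw [← lintegral_const_mul' _ _ (by norm_num), ← lintegral_const_mul' _ _ ENNReal.ofReal_ne_top,
      ← lintegral_add_left (Measurable.const_mul
        (Measurable.lintegral_prod_right (f := fun x y => ‖h (R * x) (R * y)‖ₑ ^ 2) mR) _)]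
    refine setLIntegral_mono' measurableSet_Icc fun x hx => ?_
    rw [← lintegral_const_mul' _ _ (by norm_num), ← lintegral_const_mul' _ _ ENNReal.ofReal_ne_top,
      ← lintegral_add_left (Measurable.const_mul (f := fun y => ‖h (R * x) (R * y)‖ₑ ^ 2)
        (mR.comp measurable_prodMk_left) _)]
    exact setLIntegral_mono' measurableSet_Icc fun y hy => ray x hx y hy
  refine (enorm_sq_le_average_two hc hc₁ hc₂ hc₁₂ d₁ d₂ d₁₂ hs).trans ?_
  rw [add_assoc (ENNReal.ofReal (4 / s ^ 2) * _), ← mul_add]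
  have grad : (∫⁻ x in Set.Icc 0 (2 * s), ∫⁻ y in Set.Icc 0 (2 * s), ‖h₂ x y‖ₑ ^ 2)
      + (∫⁻ x in Set.Icc 0 (2 * s), ∫⁻ y in Set.Icc 0 (2 * s), ‖h₁ x y‖ₑ ^ 2) ≤
      ∫⁻ x in Set.Icc 0 (2 * R), ∫⁻ y in Set.Icc 0 (2 * R), G x y := by
    refine le_trans (le_of_eq ?_) (mono hsub G)
    rw [add_comm, ← lintegral_add_left
      (Measurable.lintegral_prod_right (f := fun x y => ‖h₁ x y‖ₑ ^ 2) (m hc₁))]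
    exact lintegral_congr fun x => (lintegral_add_left ((m hc₁).comp measurable_prodMk_left) _).symm
  have lead : ENNReal.ofReal (4 / s ^ 2) *
        (∫⁻ x in Set.Icc s (2 * s), ∫⁻ y in Set.Icc s (2 * s), ‖h x y‖ₑ ^ 2) ≤
      ENNReal.ofReal (8 / R ^ 2) *
        (∫⁻ x in Set.Icc 0 (2 * R), ∫⁻ y in Set.Icc 0 (2 * R), ‖h x y‖ₑ ^ 2)
      + ENNReal.ofReal (64 * L) *
        ∫⁻ x in Set.Icc 0 (2 * R), ∫⁻ y in Set.Icc 0 (2 * R), G x y := by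
    rw [← setLIntegral_square_scale hc hs, ← mul_assoc, ← ENNReal.ofReal_mul (by positivity),
      div_mul_cancel₀ _ (by positivity)]
    refine (mul_le_mul_right big _).trans ?_
    rw [mul_add, ← mul_assoc, ← mul_assoc, ← ENNReal.ofReal_mul (by norm_num)]
    gcongr ?_ + ?_
    · have e : ENNReal.ofReal 4 * 2 = ENNReal.ofReal (8 / R ^ 2) * ENNReal.ofReal (R ^ 2) := by
        rw [← ENNReal.ofReal_mul (by positivity), div_mul_cancel₀ _ (by positivity),
          ← ENNReal.ofReal_ofNat, ← ENNReal.ofReal_mul (by norm_num)]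
        norm_num
      rw [e, mul_assoc, setLIntegral_square_scale hc hR]
      exact mul_le_mul_right (mono (Set.Icc_subset_Icc hR.le le_rfl) _) _
    · rw [show 4 * (16 * L) = 64 * L by ring]
      exact mul_le_mul_right (lintegral_rays_le hG hs) _
  calc _ ≤ (ENNReal.ofReal (8 / R ^ 2) *
        (∫⁻ x in Set.Icc 0 (2 * R), ∫⁻ y in Set.Icc 0 (2 * R), ‖h x y‖ₑ ^ 2)
      + ENNReal.ofReal (64 * L) *
        ∫⁻ x in Set.Icc 0 (2 * R), ∫⁻ y in Set.Icc 0 (2 * R), G x y)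
      + 8 * (∫⁻ x in Set.Icc 0 (2 * R), ∫⁻ y in Set.Icc 0 (2 * R), G x y)
      + ENNReal.ofReal (16 * s ^ 2) *
        (∫⁻ x in Set.Icc 0 (2 * R), ∫⁻ y in Set.Icc 0 (2 * R), ‖h₁₂ x y‖ₑ ^ 2) :=
        add_le_add (add_le_add lead (mul_le_mul_right grad _)) (mul_le_mul_right (mono hsub _) _)
    _ = _ := by
      rw [ENNReal.ofReal_add (by positivity) (by norm_num), ENNReal.ofReal_ofNat]
      ring

/-- The point with horizontal coordinates `(p + a, q + b)` and vertical coordinate `c`. -/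
def chart (p q a b c : ℝ) : Pt := !₂[p + a, q + b, c]

lemma chart_eq (p q a b c : ℝ) : chart p q a b c = chart p q 0 0 0
    + (a • EuclideanSpace.single 0 1 + b • EuclideanSpace.single 1 1
      + c • EuclideanSpace.single 2 1) := by
  ext i
  fin_cases i <;> simp [chart]

lemma continuous_chart (p q : ℝ) :
    Continuous fun z : ℝ × ℝ × ℝ => chart p q z.1 z.2.1 z.2.2 := by
  refine Continuous.congr ?_ fun z => (chart_eq p q z.1 z.2.1 z.2.2).symm
  fun_prop

lemma hasDerivAt_comp_chart {u : Pt → ℝ} (hu : Differentiable ℝ u) (p q : ℝ) {α β γ : ℝ → ℝ}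
    {α' β' γ' l : ℝ} (hα : HasDerivAt α α' l) (hβ : HasDerivAt β β' l) (hγ : HasDerivAt γ γ' l) :
    HasDerivAt (fun l => u (chart p q (α l) (β l) (γ l)))
      (α' * pd 0 u (chart p q (α l) (β l) (γ l)) + β' * pd 1 u (chart p q (α l) (β l) (γ l))
        + γ' * pd 2 u (chart p q (α l) (β l) (γ l))) l := by
  have h1 : HasDerivAt (fun l => chart p q (α l) (β l) (γ l))
      (α' • EuclideanSpace.single 0 1 + β' • EuclideanSpace.single 1 1
        + γ' • EuclideanSpace.single 2 1) l := by
    simp_rw [chart_eq p q (α _)]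
    exact (((hα.smul_const _).add (hβ.smul_const _)).add (hγ.smul_const _)).const_add _
  have h2 := (hu (chart p q (α l) (β l) (γ l))).hasFDerivAt.comp_hasDerivAt l h1
  simpa [pd, Function.comp_def] using h2

lemma contDiff_pd {u : Pt → ℝ} (hu : ContDiff ℝ (⊤ : ℕ∞) u) (j : Fin 3) :
    ContDiff ℝ (⊤ : ℕ∞) (pd j u) :=
  (hu.fderiv_right (m := ((⊤ : ℕ∞) : WithTop ℕ∞)) (by simp)).clm_apply contDiff_const

lemma pd_comm {u : Pt → ℝ} (hu : ContDiff ℝ (⊤ : ℕ∞) u) (i j : Fin 3) :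
    pd i (pd j u) = pd j (pd i u) := by
  have key : ∀ (i j : Fin 3) (x : Pt), pd i (pd j u) x =
      fderiv ℝ (fderiv ℝ u) x (EuclideanSpace.single i 1) (EuclideanSpace.single j 1) := by
    intro i j x
    have hd : DifferentiableAt ℝ (fderiv ℝ u) x :=
      (hu.fderiv_right (m := ((⊤ : ℕ∞) : WithTop ℕ∞)) (by simp)).differentiable (by simp) x
    change fderiv ℝ (fun y => fderiv ℝ u y (EuclideanSpace.single j 1)) x _ = _
    rw [fderiv_clm_apply hd (differentiableAt_const _)]
    simp
  funext x
  rw [key, key]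
  exact (hu.contDiffAt.isSymmSndFDerivAt
    (by rw [minSmoothness_of_isRCLikeNormedField]
        exact WithTop.coe_le_coe.2 (le_top : (2 : ℕ∞) ≤ ⊤))) _ _

lemma lintegral_slab {F : Pt → ℝ≥0∞} (hF : Measurable F) (δ : ℝ) :
    ∫⁻ y in slab δ, F y = ∫⁻ c in Set.Ico 0 δ, ∫⁻ a, ∫⁻ b, F (chart 0 0 a b c) := by
  have e1 := EuclideanSpace.volume_preserving_symm_measurableEquiv_toLp (Fin 3)
  have e2 := volume_preserving_piFinSuccAbove (fun _ : Fin 3 => ℝ) 2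
  have e3 := (MeasurePreserving.id (volume : Measure ℝ)).prod (volume_preserving_finTwoArrow ℝ)
  have e := e3.comp (e2.comp e1)
  have hm : Measurable fun z : ℝ × ℝ × ℝ => F (chart 0 0 z.2.1 z.2.2 z.1) :=
    hF.comp ((continuous_chart 0 0).comp
      (by fun_prop : Continuous fun z : ℝ × ℝ × ℝ => (z.2.1, z.2.2, z.1))).measurable
  have h := e.setLIntegral_comp_preimage (measurableSet_Ico.prod MeasurableSet.univ :
    MeasurableSet (Set.Ico 0 δ ×ˢ (Set.univ : Set (ℝ × ℝ)))) hm
  rw [setLIntegral_prod _ hm.aemeasurable] at h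
  refine Eq.trans ?_ (h.trans ?_)
  · congr 1
    · congr 1
      ext y
      simp [slab, MeasurableEquiv.piFinSuccAbove, Fin.insertNthEquiv]
    · funext y
      congr 1
      ext i
      fin_cases i <;> simp [chart, MeasurableEquiv.piFinSuccAbove, Fin.insertNthEquiv,
        MeasurableEquiv.finTwoArrow, Fin.removeNth, Fin.succAbove]
  · refine lintegral_congr fun c => ?_
    rw [Measure.restrict_univ, Measure.volume_eq_prod, lintegral_prod]
    exact (hm.comp measurable_prodMk_left).aemeasurable

lemma setLIntegral_chart_le {F : Pt → ℝ≥0∞} (hF : Measurable F) (δ p q : ℝ) (S : Set ℝ) :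
    ∫⁻ c in Set.Ico 0 δ, ∫⁻ a in S, ∫⁻ b in S, F (chart p q a b c) ≤ ∫⁻ y in slab δ, F y := by
  rw [lintegral_slab hF]
  refine lintegral_mono fun c => ?_
  calc _ ≤ ∫⁻ a, ∫⁻ b, F (chart p q a b c) :=
        (lintegral_mono fun a => setLIntegral_le_lintegral _ _).trans
          (setLIntegral_le_lintegral _ _)
    _ = ∫⁻ a, ∫⁻ b, F (chart 0 0 (p + a) (q + b) c) := by simp [chart]
    _ = ∫⁻ a, ∫⁻ b, F (chart 0 0 (p + a) b c) :=
        lintegral_congr fun a => lintegral_add_left_eq_self (fun b => F (chart 0 0 (p + a) b c)) q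
    _ = _ := lintegral_add_left_eq_self (fun a => ∫⁻ b, F (chart 0 0 a b c)) p

lemma L2_sq (δ : ℝ) (f : Pt → ℝ) : L2 δ f ^ 2 = ∫⁻ y in slab δ, ‖f y‖ₑ ^ 2 := by
  have := eLpNorm_nnreal_pow_eq_lintegral (μ := volume.restrict (slab δ)) (f := f) (p := 2)
    (by norm_num)
  simpa [L2] using this

lemma ofReal_sq_mul_le_L2_sq {κ δ : ℝ} (hκ : 0 ≤ κ) {g G : Pt → ℝ} (h : ∀ y, |g y| ≤ |G y|) :
    ENNReal.ofReal (κ ^ 2) * ∫⁻ y in slab δ, ‖g y‖ₑ ^ 2 ≤ (ENNReal.ofReal κ * L2 δ G) ^ 2 := by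
  rw [mul_pow, L2_sq, ENNReal.ofReal_pow hκ]
  gcongr with y
  exact enorm_le_iff_norm_le.2 (h y)

lemma norm_chart_le {x : Pt} {a b c : ℝ} (ha : 0 ≤ a) (hb : 0 ≤ b) (hc : 0 ≤ c) :
    ‖chart (x 0) (x 1) a b c‖ ≤ ‖x‖ + (a + b + c) := by
  rw [chart_eq]
  refine (norm_add_le _ _).trans (add_le_add ?_ ?_)
  · rw [EuclideanSpace.norm_eq, EuclideanSpace.norm_eq]
    refine Real.sqrt_le_sqrt ?_
    simp only [Fin.sum_univ_three, Real.norm_eq_abs, sq_abs]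
    simp [chart, sq_nonneg]
  · refine (norm_add₃_le).trans_eq ?_
    simp [norm_smul, abs_of_nonneg, ha, hb, hc]

lemma ofReal_sq_mul_enorm_sq_le {t d : ℝ} (ht : 0 ≤ t) (htd : t ≤ 4 * d + 4) (g : ℝ) :
    ENNReal.ofReal (t ^ 2) * ‖g‖ₑ ^ 2 ≤ 32 * (‖g‖ₑ ^ 2 + ‖d * g‖ₑ ^ 2) := by
  simp only [enorm_sq_eq_ofReal]
  rw [← ENNReal.ofReal_add (by positivity) (by positivity), ← ENNReal.ofReal_ofNat 32,
    ← ENNReal.ofReal_mul (sq_nonneg t), ← ENNReal.ofReal_mul (by norm_num)]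
  refine ENNReal.ofReal_le_ofReal ?_
  have : t ^ 2 ≤ 32 * (1 + d ^ 2) := by nlinarith [sq_nonneg (d - 1)]
  nlinarith [mul_le_mul_of_nonneg_right this (sq_nonneg g)]

/-- Interior estimate for the vertical `L²` norm of a function on a slab. -/
lemma lintegral_vertical_le {w : Pt → ℝ} (hw : ContDiff ℝ (⊤ : ℕ∞) w) {δ t : ℝ} (hδ : δ ≤ 1)
    (ht : 1 ≤ t) {x : Pt} (hx : ‖x‖ ≤ t / 2) :
    ENNReal.ofReal (t ^ 2) * ∫⁻ c in Set.Ico 0 δ, ‖w (chart (x 0) (x 1) 0 0 c)‖ₑ ^ 2 ≤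
      ENNReal.ofReal (19200 * Real.log (Real.exp 1 + t)) * ∫⁻ y in slab δ,
        (‖w y‖ₑ ^ 2 + ((‖pd 0 w y‖ₑ ^ 2 + ‖(t - ‖y‖) * pd 0 w y‖ₑ ^ 2)
          + (‖pd 1 w y‖ₑ ^ 2 + ‖(t - ‖y‖) * pd 1 w y‖ₑ ^ 2)) + ‖pd 1 (pd 0 w) y‖ₑ ^ 2) := by
  set ℓ := Real.log (Real.exp 1 + t)
  have hℓ : 1 ≤ ℓ := by
    rw [Real.le_log_iff_exp_le (by positivity)]
    linarith
  have hℓt : Real.log t ≤ ℓ :=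
    Real.log_le_log (by linarith) (by linarith [Real.exp_pos 1])
  have hw0 := contDiff_pd hw 0
  have hw1 := contDiff_pd hw 1
  have hw10 := contDiff_pd hw0 1
  have cw := hw.continuous
  have cw0 := hw0.continuous
  have cw1 := hw1.continuous
  have cw10 := hw10.continuous
  set A : Pt → ℝ≥0∞ := fun y => (‖pd 0 w y‖ₑ ^ 2 + ‖(t - ‖y‖) * pd 0 w y‖ₑ ^ 2)
          + (‖pd 1 w y‖ₑ ^ 2 + ‖(t - ‖y‖) * pd 1 w y‖ₑ ^ 2)
  set B : Pt → ℝ≥0∞ := fun y => ‖w y‖ₑ ^ 2 + A y + ‖pd 1 (pd 0 w) y‖ₑ ^ 2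
  have hAm : Measurable A := by
    have m0 : Measurable fun y => (t - ‖y‖) * pd 0 w y := by fun_prop
    have m1 : Measurable fun y => (t - ‖y‖) * pd 1 w y := by fun_prop
    exact ((cw0.measurable.enorm.pow_const 2).add (m0.enorm.pow_const 2)).add
      ((cw1.measurable.enorm.pow_const 2).add (m1.enorm.pow_const 2))
  have hBm : Measurable B := ((cw.measurable.enorm.pow_const 2).add hAm).add
    (cw10.measurable.enorm.pow_const 2)
  have key : ∀ c ∈ Set.Ico 0 δ,
      ENNReal.ofReal (t ^ 2) * ‖w (chart (x 0) (x 1) 0 0 c)‖ₑ ^ 2 ≤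
        ENNReal.ofReal (19200 * ℓ) * ∫⁻ a in Set.Icc 0 (2 * (t / 16)),
          ∫⁻ b in Set.Icc 0 (2 * (t / 16)), B (chart (x 0) (x 1) a b c) := by
    intro c hc
    have cc : Continuous fun z : ℝ × ℝ => chart (x 0) (x 1) z.1 z.2 c :=
      (continuous_chart _ _).comp (by fun_prop : Continuous fun z : ℝ × ℝ => (z.1, z.2, c))
    have ht0 : 0 < t := by linarith
    have h := enorm_sq_le_log_two (h := fun a b => w (chart (x 0) (x 1) a b c))
      (h₁ := fun a b => pd 0 w (chart (x 0) (x 1) a b c))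
      (h₂ := fun a b => pd 1 w (chart (x 0) (x 1) a b c))
      (h₁₂ := fun a b => pd 1 (pd 0 w) (chart (x 0) (x 1) a b c))
      (cw.comp cc) (cw0.comp cc) (cw1.comp cc) (cw10.comp cc)
      (fun a b => by
        simpa using hasDerivAt_comp_chart (hw.differentiable (by simp)) (x 0) (x 1)
          (hasDerivAt_id a) (hasDerivAt_const a b) (hasDerivAt_const a c))
      (fun a b => by
        simpa using hasDerivAt_comp_chart (hw.differentiable (by simp)) (x 0) (x 1)
          (hasDerivAt_const b a) (hasDerivAt_id b) (hasDerivAt_const b c))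
      (fun a b => by
        simpa using hasDerivAt_comp_chart (hw0.differentiable (by simp)) (x 0) (x 1)
          (hasDerivAt_const b a) (hasDerivAt_id b) (hasDerivAt_const b c))
      (fun a b l => by
        simpa using hasDerivAt_comp_chart (hw.differentiable (by simp)) (x 0) (x 1)
          ((hasDerivAt_id l).mul_const a) ((hasDerivAt_id l).mul_const b) (hasDerivAt_const l c))
      (s := 1 / (32 * t)) (R := t / 16) (by positivity)
      (by rw [div_le_div_iff₀ (by positivity) (by norm_num)]; nlinarith)
    have hratio : t / 16 / (1 / (32 * t)) = 2 * t ^ 2 := by field_simp; norm_num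
    rw [hratio] at h
    have hL0 : 0 ≤ Real.log (2 * t ^ 2) := Real.log_nonneg (by nlinarith)
    have hL : Real.log (2 * t ^ 2) ≤ 3 * ℓ := by
      rw [Real.log_mul (by norm_num) (by positivity), Real.log_pow]
      have := Real.log_two_lt_d9
      push_cast
      linarith
    refine (mul_le_mul_right h _).trans ?_
    set J := Set.Icc 0 (2 * (t / 16))
    set I := ∫⁻ a in J, ∫⁻ b in J, B (chart (x 0) (x 1) a b c)
    have e3 : ENNReal.ofReal (19200 * ℓ) * I = ENNReal.ofReal (6400 * ℓ) * I
        + ENNReal.ofReal (6400 * ℓ) * I + ENNReal.ofReal (6400 * ℓ) * I := by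
      rw [← add_mul, ← add_mul, ← ENNReal.ofReal_add (by positivity) (by positivity),
        ← ENNReal.ofReal_add (by positivity) (by positivity)]
      congr 2; ring
    rw [e3, mul_add, mul_add]
    refine add_le_add (add_le_add ?_ ?_) ?_
    · rw [← mul_assoc, ← ENNReal.ofReal_mul (by positivity)]
      refine mul_le_mul' (ENNReal.ofReal_le_ofReal ?_)
        (lintegral_mono fun a => lintegral_mono fun b => ?_)
      · have : t ^ 2 * (8 / (t / 16) ^ 2) = 2048 := by field_simp; norm_num
        rw [this]; linarith
      · exact le_self_add.trans le_self_add
    · have hreg : ∀ a ∈ J, ∀ b ∈ J, ENNReal.ofReal (t ^ 2) *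
          (‖pd 0 w (chart (x 0) (x 1) a b c)‖ₑ ^ 2 + ‖pd 1 w (chart (x 0) (x 1) a b c)‖ₑ ^ 2) ≤
          32 * B (chart (x 0) (x 1) a b c) := by
        intro a ha b hb
        have hn := norm_chart_le (x := x) ha.1 hb.1 hc.1
        have htd : t ≤ 4 * (t - ‖chart (x 0) (x 1) a b c‖) + 4 := by
          linarith [ha.2, hb.2, hc.2]
        rw [mul_add]
        refine (add_le_add (ofReal_sq_mul_enorm_sq_le ht0.le htd _)
          (ofReal_sq_mul_enorm_sq_le ht0.le htd _)).trans ?_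
        rw [← mul_add]
        exact mul_le_mul_right (le_add_self.trans le_self_add) _
      have hI : ENNReal.ofReal (t ^ 2) * (∫⁻ a in J, ∫⁻ b in J,
          (‖pd 0 w (chart (x 0) (x 1) a b c)‖ₑ ^ 2 + ‖pd 1 w (chart (x 0) (x 1) a b c)‖ₑ ^ 2)) ≤
          32 * I := by
        have h32 : (32 : ℝ≥0∞) ≠ ⊤ := by norm_num
        rw [← lintegral_const_mul' _ _ ENNReal.ofReal_ne_top, ← lintegral_const_mul' _ _ h32]
        refine setLIntegral_mono' measurableSet_Icc fun a ha => ?_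
        rw [← lintegral_const_mul' _ _ ENNReal.ofReal_ne_top, ← lintegral_const_mul' _ _ h32]
        exact setLIntegral_mono' measurableSet_Icc fun b hb => hreg a ha b hb
      rw [mul_left_comm]
      refine (mul_le_mul_right hI _).trans ?_
      rw [← mul_assoc]
      refine mul_le_mul_left ?_ _
      rw [← ENNReal.ofReal_ofNat, ← ENNReal.ofReal_mul (by positivity)]
      refine ENNReal.ofReal_le_ofReal ?_
      linarith
    · rw [← mul_assoc, ← ENNReal.ofReal_mul (by positivity)]
      refine mul_le_mul' (ENNReal.ofReal_le_ofReal ?_)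
        (lintegral_mono fun a => lintegral_mono fun b => ?_)
      · have : t ^ 2 * (16 * (1 / (32 * t)) ^ 2) = 1 / 64 := by field_simp; norm_num
        rw [this]; linarith
      · exact le_add_self
  rw [← lintegral_const_mul' _ _ ENNReal.ofReal_ne_top]
  refine (setLIntegral_mono' measurableSet_Ico key).trans ?_
  rw [lintegral_const_mul' _ _ ENNReal.ofReal_ne_top]
  exact mul_le_mul_right (setLIntegral_chart_le hBm δ (x 0) (x 1) _) _

lemma mul_lintegral_vertical_le {w : Pt → ℝ} (hw : ContDiff ℝ (⊤ : ℕ∞) w) {δ t : ℝ} (hδ : δ ≤ 1)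
    (ht : 1 ≤ t) {x : Pt} (hx : ‖x‖ ≤ t / 2) {k M : ℝ≥0∞}
    (h : k * ∫⁻ y in slab δ, ‖w y‖ₑ ^ 2 ≤ M)
    (h₀ : k * ∫⁻ y in slab δ, ‖pd 0 w y‖ₑ ^ 2 ≤ M)
    (h₁ : k * ∫⁻ y in slab δ, ‖pd 1 w y‖ₑ ^ 2 ≤ M)
    (h₀' : k * ∫⁻ y in slab δ, ‖(t - ‖y‖) * pd 0 w y‖ₑ ^ 2 ≤ M)
    (h₁' : k * ∫⁻ y in slab δ, ‖(t - ‖y‖) * pd 1 w y‖ₑ ^ 2 ≤ M)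
    (h₁₀ : k * ∫⁻ y in slab δ, ‖pd 1 (pd 0 w) y‖ₑ ^ 2 ≤ M) :
    ENNReal.ofReal (t ^ 2) * (k * ∫⁻ c in Set.Ico 0 δ, ‖w (chart (x 0) (x 1) 0 0 c)‖ₑ ^ 2) ≤
      ENNReal.ofReal (19200 * Real.log (Real.exp 1 + t)) * (6 * M) := by
  have m : ∀ {g : Pt → ℝ}, Measurable g → Measurable fun y => ‖g y‖ₑ ^ 2 :=
    fun hg => hg.enorm.pow_const 2
  have c0 := (contDiff_pd hw 0).continuous
  have c1 := (contDiff_pd hw 1).continuous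
  have m0 := m c0.measurable
  have m1 := m c1.measurable
  have m0' := m (by fun_prop : Measurable fun y => (t - ‖y‖) * pd 0 w y)
  have m1' := m (by fun_prop : Measurable fun y => (t - ‖y‖) * pd 1 w y)
  rw [mul_left_comm]
  refine (mul_le_mul_right (lintegral_vertical_le hw hδ ht hx) k).trans ?_
  rw [mul_left_comm]
  refine mul_le_mul_right ?_ _
  have mw := m hw.continuous.measurable
  have a0 : Measurable fun y => ‖pd 0 w y‖ₑ ^ 2 + ‖(t - ‖y‖) * pd 0 w y‖ₑ ^ 2 := m0.add m0'
  have a1 : Measurable fun y => ‖pd 1 w y‖ₑ ^ 2 + ‖(t - ‖y‖) * pd 1 w y‖ₑ ^ 2 := m1.add m1'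
  have a2 : Measurable fun y => ‖w y‖ₑ ^ 2 +
      ((‖pd 0 w y‖ₑ ^ 2 + ‖(t - ‖y‖) * pd 0 w y‖ₑ ^ 2)
        + (‖pd 1 w y‖ₑ ^ 2 + ‖(t - ‖y‖) * pd 1 w y‖ₑ ^ 2)) := mw.add (a0.add a1)
  rw [lintegral_add_left a2, lintegral_add_left mw, lintegral_add_left a0,
    lintegral_add_left m0, lintegral_add_left m1]
  simp only [mul_add]
  calc _ ≤ M + ((M + M) + (M + M)) + M := by gcongr
    _ = _ := by ring

lemma le_sum_sum {ι : Type*} [Fintype ι] (v : ι → ι → ℝ) (hv : ∀ i j, 0 ≤ v i j) (i j : ι) :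
    v i j ≤ ∑ i, ∑ j, v i j :=
  (Finset.single_le_sum (f := v i) (fun _ _ => hv _ _) (Finset.mem_univ j)).trans
    (Finset.single_le_sum (f := fun i => ∑ j, v i j)
      (fun _ _ => Finset.sum_nonneg fun _ _ => hv _ _) (Finset.mem_univ i))

lemma abs_mul_le_abs_mul_sqrt (d : ℝ) {a b : ℝ} (h : a ^ 2 ≤ b) : |d * a| ≤ |d * √b| := by
  rw [abs_mul, abs_mul, abs_of_nonneg (Real.sqrt_nonneg b)]
  exact mul_le_mul_of_nonneg_left (Real.abs_le_sqrt h) (abs_nonneg d)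

theorem interior_decay_estimate :
    ∃ C : ℝ, 0 < C ∧
      ∀ (δ : ℝ), 0 < δ → δ ≤ 1 →
      ∀ (t : ℝ), 1 ≤ t →
      ∀ f : STF, ContDiff ℝ (⊤ : ℕ∞) (fun q : ℝ × Pt => f q.1 q.2) →
        (∀ s x, f s (x + δ • e3) = f s x) →
      ∀ x : Pt, x ∈ slab δ → ‖x‖ ≤ t / 2 →
        ENNReal.ofReal (t * (Real.log (Real.exp 1 + t)) ^ (-(1:ℝ)/2)
            * Real.sqrt (∑ j, (pd j (f t) x)^2)) ≤
          ENNReal.ofReal C *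
            (ENNReal.ofReal (δ ^ (-(1:ℝ)/2)) *
                L2 δ (fun y => (t - ‖y‖) * Real.sqrt (∑ j, ∑ k, (pd j (pd k (f t)) y)^2))
              + ENNReal.ofReal (δ ^ ((1:ℝ)/2)) *
                L2 δ (fun y => (t - ‖y‖) *
                  Real.sqrt (∑ j, ((pd 2 (pd 0 (pd j (f t))) y)^2
                                   + (pd 2 (pd 1 (pd j (f t))) y)^2)))
              + ENNReal.ofReal (δ ^ (-(1:ℝ)/2)) *
                  ∑ a ∈ idx7 2, L2 δ (fun y => Real.sqrt (∑ j, (pd j (Za a f t) y)^2))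
              + ENNReal.ofReal (δ ^ ((1:ℝ)/2)) *
                  ∑ a ∈ idx7 2,
                    L2 δ (fun y => Real.sqrt (∑ j, ∑ k, (pd j (pd k (Za a f t)) y)^2))) := by
  refine ⟨2000, by norm_num, ?_⟩
  intro δ hδ0 hδ1 t ht f hf _ x hxs hx
  have hu : ContDiff ℝ (⊤ : ℕ∞) (f t) :=
    hf.comp (contDiff_const.prodMk contDiff_id : ContDiff ℝ (⊤ : ℕ∞) fun y : Pt => (t, y))
  have k1 : (0 : ℝ) ≤ δ ^ (-(1 : ℝ) / 2) := by positivity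
  have k2 : (0 : ℝ) ≤ δ ^ ((1 : ℝ) / 2) := by positivity
  have sq1 : (δ ^ (-(1 : ℝ) / 2)) ^ 2 = δ⁻¹ := by
    rw [← Real.rpow_natCast, ← Real.rpow_mul hδ0.le, ← Real.rpow_neg_one]
    norm_num
  have sq2 : (δ ^ ((1 : ℝ) / 2)) ^ 2 = δ := by
    rw [← Real.rpow_natCast, ← Real.rpow_mul hδ0.le]
    norm_num
  set T₁ := ENNReal.ofReal (δ ^ (-(1:ℝ)/2)) *
    L2 δ (fun y => (t - ‖y‖) * Real.sqrt (∑ j, ∑ k, (pd j (pd k (f t)) y)^2))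
  set T₂ := ENNReal.ofReal (δ ^ ((1:ℝ)/2)) *
    L2 δ (fun y => (t - ‖y‖) *
      Real.sqrt (∑ j, ((pd 2 (pd 0 (pd j (f t))) y)^2 + (pd 2 (pd 1 (pd j (f t))) y)^2)))
  set T₃ := ENNReal.ofReal (δ ^ (-(1:ℝ)/2)) *
    ∑ a ∈ idx7 2, L2 δ (fun y => Real.sqrt (∑ j, (pd j (Za a f t) y)^2))
  set T₄ := ENNReal.ofReal (δ ^ ((1:ℝ)/2)) *
    ∑ a ∈ idx7 2,
      L2 δ (fun y => Real.sqrt (∑ j, ∑ k, (pd j (pd k (Za a f t)) y)^2))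
  set E := T₁ + T₂ + T₃ + T₄ with hE
  have le₁ : T₁ ≤ E := by rw [hE, add_assoc, add_assoc]; exact le_self_add
  have le₂ : T₂ ≤ E := by rw [hE, add_assoc]; exact le_add_self.trans le_self_add
  have le₃ : T₃ ≤ E := le_add_self.trans le_self_add
  have le₄ : T₄ ≤ E := le_add_self
  have b₁ : ∀ i j, ENNReal.ofReal δ⁻¹ *
      ∫⁻ y in slab δ, ‖(t - ‖y‖) * pd i (pd j (f t)) y‖ₑ ^ 2 ≤ E ^ 2 := by
    intro i j
    rw [← sq1]
    refine (ofReal_sq_mul_le_L2_sq k1 fun y => ?_).trans (pow_le_pow_left' le₁ 2)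
    exact abs_mul_le_abs_mul_sqrt _
      (le_sum_sum (fun i j => (pd i (pd j (f t)) y) ^ 2) (fun _ _ => sq_nonneg _) i j)
  have b₂ : ∀ i ∈ ({0, 1} : Set (Fin 3)), ∀ j, ENNReal.ofReal δ *
      ∫⁻ y in slab δ, ‖(t - ‖y‖) * pd 2 (pd i (pd j (f t))) y‖ₑ ^ 2 ≤ E ^ 2 := by
    intro i hi j
    nth_rw 1 [← sq2]
    refine (ofReal_sq_mul_le_L2_sq k2 fun y => ?_).trans (pow_le_pow_left' le₂ 2)
    refine abs_mul_le_abs_mul_sqrt _ (le_trans ?_ (Finset.single_le_sum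
      (f := fun j => (pd 2 (pd 0 (pd j (f t))) y)^2 + (pd 2 (pd 1 (pd j (f t))) y)^2)
      (fun _ _ => by positivity) (Finset.mem_univ j)))
    rcases hi with rfl | rfl
    · exact le_add_of_nonneg_right (sq_nonneg _)
    · exact le_add_of_nonneg_left (sq_nonneg _)
  have b₃ : ∀ a ∈ idx7 2, ∀ j, ENNReal.ofReal δ⁻¹ *
      ∫⁻ y in slab δ, ‖pd j (Za a f t) y‖ₑ ^ 2 ≤ E ^ 2 := by
    intro a ha j
    rw [← sq1]
    refine (ofReal_sq_mul_le_L2_sq (G := fun y => √(∑ j, (pd j (Za a f t) y) ^ 2)) k1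
      fun y => ?_).trans (pow_le_pow_left' (le_trans ?_ le₃) 2)
    · exact (Real.abs_le_sqrt (Finset.single_le_sum (f := fun j => (pd j (Za a f t) y) ^ 2)
        (fun _ _ => sq_nonneg _) (Finset.mem_univ j))).trans (le_abs_self _)
    · exact mul_le_mul_right (Finset.single_le_sum
        (f := fun a => L2 δ (fun y => √(∑ j, (pd j (Za a f t) y) ^ 2)))
        (fun _ _ => zero_le) ha) _
  have b₄ : ∀ a ∈ idx7 2, ∀ i j, ENNReal.ofReal δ *
      ∫⁻ y in slab δ, ‖pd i (pd j (Za a f t)) y‖ₑ ^ 2 ≤ E ^ 2 := by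
    intro a ha i j
    nth_rw 1 [← sq2]
    refine (ofReal_sq_mul_le_L2_sq (G := fun y => √(∑ i, ∑ j, (pd i (pd j (Za a f t)) y) ^ 2)) k2
      fun y => ?_).trans (pow_le_pow_left' (le_trans ?_ le₄) 2)
    · exact (Real.abs_le_sqrt (le_sum_sum (fun i j => (pd i (pd j (Za a f t)) y) ^ 2)
        (fun _ _ => sq_nonneg _) i j)).trans (le_abs_self _)
    · exact mul_le_mul_right (Finset.single_le_sum
        (f := fun a => L2 δ (fun y => √(∑ i, ∑ j, (pd i (pd j (Za a f t)) y) ^ 2)))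
        (fun _ _ => zero_le) ha) _
  have m0 : (0 : Fin 7 → ℕ) ∈ idx7 2 := by simp [idx7]
  have m1 : ![0, 1, 0, 0, 0, 0, 0] ∈ idx7 2 := by decide
  have m2 : ![0, 0, 1, 0, 0, 0, 0] ∈ idx7 2 := by decide
  have m3 : ![0, 1, 1, 0, 0, 0, 0] ∈ idx7 2 := by decide
  set ℓ := Real.log (Real.exp 1 + t)
  have hℓ : 1 ≤ ℓ := by
    rw [Real.le_log_iff_exp_le (by positivity)]
    linarith
  have ht0 : 0 < t := by linarith
  have hℓ0 : 0 < ℓ := by linarith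
  have comp : ∀ j, ENNReal.ofReal (t ^ 2) * ‖pd j (f t) x‖ₑ ^ 2 ≤
      ENNReal.ofReal (460800 * ℓ) * E ^ 2 := by
    intro j
    have hj := contDiff_pd hu j
    have hj2 := contDiff_pd hj 2
    have hi : ∀ i, pd i (pd 2 (pd j (f t))) = pd 2 (pd i (pd j (f t))) := fun i => pd_comm hj i 2
    have hij : ∀ i, pd i (pd j (f t)) = pd j (pd i (f t)) := fun i => pd_comm hu i j
    have h10 : pd 1 (pd 0 (pd j (f t))) = pd j (pd 0 (pd 1 (f t))) := by
      rw [hij 0, pd_comm (contDiff_pd hu 0) 1 j, pd_comm hu 1 0]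
    have v1 := mul_lintegral_vertical_le hj hδ1 ht hx (b₃ 0 m0 j)
      (by rw [hij]; exact b₃ _ m1 j) (by rw [hij]; exact b₃ _ m2 j) (b₁ 0 j) (b₁ 1 j)
      (by rw [h10]; exact b₃ _ m3 j)
    have v2 := mul_lintegral_vertical_le hj2 hδ1 ht hx (b₄ 0 m0 2 j)
      (by rw [hi, hij]; exact b₄ _ m1 2 j) (by rw [hi, hij]; exact b₄ _ m2 2 j)
      (by rw [hi]; exact b₂ 0 (by simp) j) (by rw [hi]; exact b₂ 1 (by simp) j)
      (by rw [hi, pd_comm (contDiff_pd hj 0) 1 2, h10]; exact b₄ _ m3 2 j)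
    have d : ∀ c, HasDerivAt (fun c => pd j (f t) (chart (x 0) (x 1) 0 0 c))
        (pd 2 (pd j (f t)) (chart (x 0) (x 1) 0 0 c)) c := fun c => by
      simpa using hasDerivAt_comp_chart (hj.differentiable (by simp)) (x 0) (x 1)
        (hasDerivAt_const c 0) (hasDerivAt_const c 0) (hasDerivAt_id c)
    have av := enorm_sq_le_average d (hj2.continuous.comp ((continuous_chart (x 0) (x 1)).comp
      (by fun_prop : Continuous fun c : ℝ => ((0 : ℝ), (0 : ℝ), c)))) (lo := 0) (hi := δ) (m := 0)
      (z := x 2) ⟨le_rfl, hδ0⟩ ⟨hxs.1, hxs.2.le⟩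
    have hxc : chart (x 0) (x 1) 0 0 (x 2) = x := by
      ext i; fin_cases i <;> simp [chart]
    rw [hxc, sub_zero, restrict_Ico_eq_restrict_Icc.symm, div_eq_mul_inv,
      ENNReal.ofReal_mul (by norm_num), ENNReal.ofReal_mul (by norm_num), mul_assoc, mul_assoc,
      ← mul_add] at av
    refine (mul_le_mul_right av _).trans ?_
    rw [mul_left_comm, mul_add]
    refine (mul_le_mul_right (add_le_add v1 v2) _).trans_eq ?_
    rw [show 460800 * ℓ = 24 * (19200 * ℓ) by ring, ENNReal.ofReal_mul (by norm_num) (p := 24),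
      ENNReal.ofReal_ofNat, ENNReal.ofReal_ofNat]
    ring
  have hsum : ENNReal.ofReal (t ^ 2 * ∑ j, (pd j (f t) x) ^ 2) ≤
      ENNReal.ofReal (1382400 * ℓ) * E ^ 2 := by
    rw [ENNReal.ofReal_mul (by positivity), ENNReal.ofReal_sum_of_nonneg fun _ _ => sq_nonneg _]
    rw [Finset.mul_sum]
    refine (Finset.sum_le_sum fun j _ => (enorm_sq_eq_ofReal (pd j (f t) x)) ▸ comp j).trans_eq ?_
    rw [show 1382400 * ℓ = 3 * (460800 * ℓ) by ring, ENNReal.ofReal_mul (by norm_num) (p := 3)]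
    simp [mul_assoc]
  rw [← ENNReal.pow_le_pow_left_iff two_ne_zero, mul_pow, ← ENNReal.ofReal_pow (by positivity),
    ← ENNReal.ofReal_pow (by norm_num)]
  have hsq : (t * ℓ ^ (-(1:ℝ)/2) * √(∑ j, (pd j (f t) x) ^ 2)) ^ 2 =
      ℓ⁻¹ * (t ^ 2 * ∑ j, (pd j (f t) x) ^ 2) := by
    have : (ℓ ^ (-(1 : ℝ) / 2)) ^ 2 = ℓ⁻¹ := by
      rw [← Real.rpow_natCast, ← Real.rpow_mul (by linarith), ← Real.rpow_neg_one]
      norm_num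
    rw [mul_pow, mul_pow, this, Real.sq_sqrt (Finset.sum_nonneg fun _ _ => sq_nonneg _)]
    ring
  rw [hsq, ENNReal.ofReal_mul (by positivity)]
  refine (mul_le_mul_right hsum _).trans ?_
  rw [← mul_assoc, ← ENNReal.ofReal_mul (by positivity)]
  refine mul_le_mul_left (ENNReal.ofReal_le_ofReal ?_) _
  rw [mul_left_comm, inv_mul_cancel₀ (by positivity)]
  norm_num

end Stmt8
end
end
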